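/- arXiv:2506.07409 — 2 statements merged into one kernel-verified Lean document; each statement's English description precedes it below -/
import Mathlib

section
/- Let H be a finite-dimensional Hopf algebra over a field k with antipode S, normalized integrals λ, Λ, and distinguished grouplike α ∈ H*. Let n > k > 0 be coprime with n − k odd, k₀ = (n−k−1)/2, (c_ℓ) the standard sequence, and Y' = λ ∘ S ∘ m ∘ σ_{(n,−k)} : H^{⊗n} → k. Then for all x, w₁, …, w_{k₀} ∈ H: Y'( ⨂_{ℓ=1}^{k₀} S^{2c_ℓ}(w_ℓ · x₍ℓ₎ · Λ₍ℓ₎) ⊗ ⨂_{ℓ=k₀+1}^{n} S^{2c_ℓ}(Λ₍ℓ₎) ) = Y'( ⨂_{ℓ=1}^{k₀} S^{2c_ℓ}(S²(x₍ℓ₎) · w_ℓ · Λ₍ℓ₎) ⊗ ⨂_{ℓ=k₀+1}^{n} S^{2c_ℓ}(Λ₍ℓ₎) ), where x₍ℓ₎ are the components of Δ^{k₀}(x). -/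
/-!
STATEMENT 16 (Lemma `l:t3`):
Let H be a finite-dimensional Hopf algebra with antipode S, normalized integrals λ, Λ,
distinguished grouplike α, coprime n > K > 0 with n − K odd, k₀ = (n−K−1)/2, (c_ℓ) the
standard sequence, and Y' = λ ∘ S ∘ m ∘ σ_{(n,−K)} : H^{⊗n} → k.  For all
x, w₁, …, w_{k₀} ∈ H:
  Y'( ⨂_{ℓ≤k₀} S^{2c_ℓ}(w_ℓ · x₍ℓ₎ · Λ₍ℓ₎) ⊗ ⨂_{ℓ>k₀} S^{2c_ℓ}(Λ₍ℓ₎) )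
    = Y'( ⨂_{ℓ≤k₀} S^{2c_ℓ}(S²(x₍ℓ₎) · w_ℓ · Λ₍ℓ₎) ⊗ ⨂_{ℓ>k₀} S^{2c_ℓ}(Λ₍ℓ₎) ),
where x₍ℓ₎ are the components of Δ^{k₀}(x) and Λ₍ℓ₎ those of Δⁿ(Λ) (encoded by
finite-sum representations), and Y' of a pure tensor v is λ(S(∏_t v_{σ(t)})) for the
permutation σ = σ_{(n,−K)} of {1,…,n}, σ(i) = −iK mod n.
-/

open TensorProduct

structure AlgBundle (k : Type) [CommRing k] where
  carrier : Type
  ring : Ring carrier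
  alg : @Algebra k carrier _ ring.toSemiring

section
variable (k H : Type) [Field k] [Ring H] [HopfAlgebra k H]

noncomputable def tpowB : ℕ → AlgBundle k
  | 0 => ⟨H, inferInstance, inferInstance⟩
  | n + 1 =>
      letI := (tpowB n).ring
      letI := (tpowB n).alg
      ⟨TensorProduct k H (tpowB n).carrier, inferInstance, inferInstance⟩

/-- `Tpow k H n` is the (n+1)-fold tensor power `H ⊗ (H ⊗ (⋯ ⊗ H))`. -/
noncomputable def Tpow (n : ℕ) : Type := (tpowB k H n).carrier

noncomputable instance instTpowRing (n : ℕ) : Ring (Tpow k H n) := (tpowB k H n).ring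
noncomputable instance instTpowAlgebra (n : ℕ) : Algebra k (Tpow k H n) := (tpowB k H n).alg

/-- The iterated comultiplication `Δ^{n+1} : H → H^{⊗(n+1)}`. -/
noncomputable def comulIter : ∀ n : ℕ, H →ₗ[k] Tpow k H n
  | 0 => LinearMap.id
  | n + 1 =>
      show H →ₗ[k] TensorProduct k H (Tpow k H n) from
        (TensorProduct.map LinearMap.id (comulIter n)) ∘ₗ Coalgebra.comul

/-- The higher twists of `F`:  `Fseq F n = F_{n+1}`. -/
noncomputable def Fseq (F : H ⊗[k] H) : ∀ n : ℕ, Tpow k H n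
  | 0 => 1
  | n + 1 =>
      show TensorProduct k H (Tpow k H n) from
        ((1 : H) ⊗ₜ[k] Fseq F n) * (TensorProduct.map LinearMap.id (comulIter k H n) F)

/-- Cast between tensor powers of equal length. -/
noncomputable def tcast {a b : ℕ} (h : a = b) : Tpow k H a ≃ₗ[k] Tpow k H b :=
  h ▸ LinearEquiv.refl k (Tpow k H a)

/-- The canonical identification `H^{⊗(a+1)} ⊗ H^{⊗(b+1)} ≅ H^{⊗(a+b+2)}`. -/
noncomputable def concEquiv : ∀ a b : ℕ, (Tpow k H a ⊗[k] Tpow k H b) ≃ₗ[k] Tpow k H (a + 1 + b)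
  | 0, b =>
      (show (Tpow k H 0 ⊗[k] Tpow k H b) ≃ₗ[k] Tpow k H (b + 1) from
        LinearEquiv.refl k (Tpow k H 0 ⊗[k] Tpow k H b)).trans (tcast k H (by omega))
  | a + 1, b =>
      (show (Tpow k H (a+1) ⊗[k] Tpow k H b) ≃ₗ[k] H ⊗[k] (Tpow k H a ⊗[k] Tpow k H b) from
        TensorProduct.assoc k H (Tpow k H a) (Tpow k H b)).trans
      ((TensorProduct.congr (LinearEquiv.refl k H) (concEquiv a b)).trans
        ((show (TensorProduct k H (Tpow k H (a + 1 + b))) ≃ₗ[k] Tpow k H (a + 1 + b + 1) from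
            LinearEquiv.refl k _).trans (tcast k H (by omega))))


/-- The nested pure tensor `f 0 ⊗ f 1 ⊗ ⋯ ⊗ f n` of a tuple. -/
noncomputable def nest : ∀ n : ℕ, (Fin (n + 1) → H) → Tpow k H n
  | 0, f => f 0
  | n + 1, f =>
      show TensorProduct k H (Tpow k H n) from f 0 ⊗ₜ[k] nest n (fun i => f i.succ)

/-- Integer powers of the antipode, `Spow S Sinv z = S^z`. -/
noncomputable def Spow (S Sinv : H →ₗ[k] H) (z : ℤ) : H →ₗ[k] H :=
  if 0 ≤ z then S ^ z.toNat else Sinv ^ (-z).toNat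

end

/-- least positive residue of `a` modulo `n` (valued in {1, …, n} for n ≥ 1). -/
def lpr (a n : ℕ) : ℕ := (a + n - 1) % n + 1

/-- the three-case recursion of Definition `d:cp` for the pair (n, K), with
`k₀ = (n − K − 1)/2`, and initial condition `c n = 0`. -/
def IsCSeq (n K : ℕ) (c : ℕ → ℤ) : Prop :=
  c n = 0 ∧
  (∀ i : ℕ, 1 ≤ i → i ≤ (n - K - 1) / 2 → c (i + K) = c i + 1) ∧
  (∀ i : ℕ, (n - K - 1) / 2 + 1 ≤ i → i ≤ 2 * ((n - K - 1) / 2) → c (i + K) = c i - 1) ∧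
  (∀ i : ℕ, 2 * ((n - K - 1) / 2) + 1 ≤ i → i ≤ n → c (lpr (i + K) n) = c i)

section T16Hopf
open Coalgebra WithConv HopfAlgebra

variable {k H : Type} [Field k] [Ring H] [HopfAlgebra k H]

lemma t16_toConv_apply {A B : Type*} [AddCommMonoid A] [Module k A] [AddCommMonoid B] [Module k B]
    (f : A →ₗ[k] B) (x : A) : (toConv f) x = f x := rfl

/-- convolution product through the antipode, reversed. -/
lemma t16_comul_antipode (x : H) :
    comul (R := k) (antipode k x) =
      ∑ i ∈ (ℛ k x).index, antipode k ((ℛ k x).right i) ⊗ₜ[k] antipode k ((ℛ k x).left i) := by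
  let i1 : H →ₐ[k] H ⊗[k] H := Algebra.TensorProduct.includeLeft
  let i2 : H →ₐ[k] H ⊗[k] H := Algebra.TensorProduct.includeRight
  have inv : ∀ i : H →ₐ[k] H ⊗[k] H,
      toConv (i.toLinearMap ∘ₗ antipode k) * toConv (i.toLinearMap) = 1 := by
    intro i
    have := LinearMap.algHom_comp_convMul_distrib (R := k) i
      (toConv (antipode k (A := H))) (toConv LinearMap.id)
    rw [LinearMap.antipode_mul_id] at this
    apply WithConv.ext
    refine Eq.trans this.symm ?_
    ext h
    simp [LinearMap.convOne_def]
  have hd : toConv (comul (R := k) (A := H)) = toConv i1.toLinearMap * toConv i2.toLinearMap := by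
    ext h
    rw [(ℛ k h).convMul_apply]
    simp [i1, i2]
    exact (ℛ k h).eq.symm
  have h1 : (toConv (i2.toLinearMap ∘ₗ antipode k) * toConv (i1.toLinearMap ∘ₗ antipode k)) *
      toConv (comul (R := k) (A := H)) = 1 := by
    rw [hd, mul_assoc, ← mul_assoc (toConv (i1.toLinearMap ∘ₗ antipode k)), inv i1, one_mul, inv i2]
  have h2 := left_inv_eq_right_inv h1 LinearMap.comul_right_inv
  have h3 := congrArg (fun f => f x) h2
  simp only [] at h3
  rw [(ℛ k x).convMul_apply] at h3
  refine Eq.trans h3.symm ?_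
  simp [i1, i2]

lemma t16_conv_antipode {A : Type*} [Ring A] [Algebra k A] (φ ψ : WithConv (H →ₗ[k] A)) (x : H) :
    (φ * ψ) (antipode k x) =
      ∑ i ∈ (ℛ k x).index, φ (antipode k ((ℛ k x).right i)) * ψ (antipode k ((ℛ k x).left i)) := by
  rw [LinearMap.convMul_apply, t16_comul_antipode]
  simp

lemma t16_conv_Sinv {A : Type*} [Ring A] [Algebra k A] (φ ψ : WithConv (H →ₗ[k] A))
    (Sinv : H →ₗ[k] H)
    (h1 : ∀ h, Sinv (antipode k h) = h) (h2 : ∀ h, antipode k (Sinv h) = h)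
    (hc : ∀ x y, Commute (φ x) (ψ y)) :
    toConv ((φ * ψ).ofConv ∘ₗ Sinv) =
      toConv (ψ.ofConv ∘ₗ Sinv) * toConv (φ.ofConv ∘ₗ Sinv) := by
  ext x
  obtain ⟨y, rfl⟩ : ∃ y, x = antipode k y := ⟨Sinv x, (h2 x).symm⟩
  rw [t16_conv_antipode]
  simp only [LinearMap.comp_apply, h1]
  change (φ * ψ) y = _
  rw [(ℛ k y).convMul_apply]
  exact Finset.sum_congr rfl fun i _ => hc _ _

lemma t16_Sinv_mul (Sinv : H →ₗ[k] H)
    (h1 : ∀ h, Sinv (antipode k h) = h) (h2 : ∀ h, antipode k (Sinv h) = h) (a b : H) :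
    Sinv (a * b) = Sinv b * Sinv a := by
  rw [← h1 (Sinv b * Sinv a), antipode_mul_antidistrib, h2, h2]

lemma t16_comul_mul (a b : H) : comul (R := k) (a * b) =
    ∑ i ∈ (ℛ k a).index, ∑ j ∈ (ℛ k b).index,
      ((ℛ k a).left i * (ℛ k b).left j) ⊗ₜ[k] ((ℛ k a).right i * (ℛ k b).right j) := by
  rw [Bialgebra.comul_mul]
  conv_lhs => rw [← (ℛ k a).eq, ← (ℛ k b).eq]
  rw [Finset.sum_mul_sum]
  simp only [Algebra.TensorProduct.tmul_mul_tmul]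

/-- Radford: `λ(ab) = λ(S²(b ↼ α) a)`. -/
lemma t16_radford [FiniteDimensional k H]
    (Sinv : H →ₗ[k] H)
    (h1 : ∀ h, Sinv (antipode k h) = h) (h2 : ∀ h, antipode k (Sinv h) = h)
    (lam : H →ₗ[k] k) (Λ : H)
    (hΛ : ∀ h : H, h * Λ = Coalgebra.counit (R := k) h • Λ)
    (hlam : ∀ h : H,
      (TensorProduct.lid k H) ((TensorProduct.map lam LinearMap.id)
        (Coalgebra.comul (R := k) h)) = lam h • (1 : H))
    (hnorm : lam Λ = 1)
    (α : H →ₗ[k] k) (hα : ∀ h : H, Λ * h = α h • Λ) (a b : H) :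
    lam (a * b) = ∑ i ∈ (ℛ k b).index,
      α ((ℛ k b).left i) • lam (antipode k (antipode k ((ℛ k b).right i)) * a) := by
  -- the pairing ψ
  let Ψ : (H →ₗ[k] k) →ₗ[k] H :=
    ∑ i ∈ (ℛ k Λ).index, (LinearMap.applyₗ ((ℛ k Λ).left i)).smulRight ((ℛ k Λ).right i)
  have hΨ : ∀ g, Ψ g = ∑ i ∈ (ℛ k Λ).index, g ((ℛ k Λ).left i) • ((ℛ k Λ).right i) := by
    intro g; simp [Ψ, LinearMap.sum_apply]
  -- left multiplications
  let lm : H →ₗ[k] H →ₗ[k] k := (LinearMap.mul k H).compr₂ lam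
  let rm : H →ₗ[k] H →ₗ[k] k := (LinearMap.mul k H).flip.compr₂ lam
  have hlm : ∀ u, antipode k (Ψ (lm u)) = u := by
    have : toConv (antipode k ∘ₗ Ψ ∘ₗ lm) * toConv (antipode k) = 1 := by
      ext u
      rw [(ℛ k u).convMul_apply]
      simp only [LinearMap.comp_apply, ← antipode_mul_antidistrib]
      rw [← map_sum]
      have e : ∑ i ∈ (ℛ k u).index, (ℛ k u).right i * Ψ (lm ((ℛ k u).left i)) =
          lam (u * Λ) • (1 : H) := by
        rw [← hlam, t16_comul_mul]
        simp [hΨ, lm, Finset.mul_sum]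
      rw [e, hΛ, map_smul, map_smul, hnorm, antipode_one]
      simp [Algebra.algebraMap_eq_smul_one]
    have h3 := left_inv_eq_right_inv this LinearMap.antipode_mul_id
    intro u
    exact congrArg (fun f => f u) h3
  have hrm : ∀ u, Ψ (rm u) = ∑ i ∈ (ℛ k u).index,
      α ((ℛ k u).left i) • antipode k ((ℛ k u).right i) := by
    have : toConv (Ψ ∘ₗ rm) * toConv (LinearMap.id) = toConv (Algebra.linearMap k H ∘ₗ α) := by
      ext u
      rw [(ℛ k u).convMul_apply]
      simp only [LinearMap.comp_apply, LinearMap.id_apply]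
      have e : ∑ i ∈ (ℛ k u).index, Ψ (rm ((ℛ k u).left i)) * (ℛ k u).right i =
          lam (Λ * u) • (1 : H) := by
        rw [← hlam, t16_comul_mul]
        simp only [hΨ, rm, Finset.sum_mul]
        rw [Finset.sum_comm]
        simp
      rw [e, hα, map_smul, hnorm]
      simp [Algebra.algebraMap_eq_smul_one]
    have h3 : toConv (Ψ ∘ₗ rm) = toConv (Algebra.linearMap k H ∘ₗ α) * toConv (antipode k) := by
      rw [← this, mul_assoc, LinearMap.id_mul_antipode, mul_one]
    intro u
    have h4 := congrArg (fun f => f u) h3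
    simp only [] at h4
    rw [(ℛ k u).convMul_apply] at h4
    refine Eq.trans h4 ?_
    simp [Algebra.algebraMap_eq_smul_one]
  have hsurj : Function.Surjective Ψ := by
    intro y
    refine ⟨lm (antipode k y), ?_⟩
    rw [← h1 (Ψ (lm (antipode k y))), hlm, h1]
  have hinj : Function.Injective Ψ := by
    refine (LinearMap.injective_iff_surjective_of_finrank_eq_finrank ?_).2 hsurj
    exact Subspace.dual_finrank_eq
  have key : rm b = ∑ i ∈ (ℛ k b).index,
      α ((ℛ k b).left i) • lm (antipode k (antipode k ((ℛ k b).right i))) := by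
    apply hinj
    rw [hrm, map_sum]
    refine Finset.sum_congr rfl fun i _ => ?_
    rw [map_smul, ← h1 (Ψ _), hlm, h1]
  have := congrArg (fun f => f a) key
  simpa [rm, lm, LinearMap.sum_apply] using this

end T16Hopf
section T16Core
open Coalgebra WithConv HopfAlgebra

/-- `φ 0 * φ 1 * ⋯ * φ (m-1)` -/
def t16P {M : Type*} [Monoid M] (φ : ℕ → M) : ℕ → M
  | 0 => 1
  | m + 1 => t16P φ m * φ m

/-- `φ (m-1) * ⋯ * φ 1 * φ 0` -/
def t16Q {M : Type*} [Monoid M] (φ : ℕ → M) : ℕ → M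
  | 0 => 1
  | m + 1 => φ m * t16Q φ m

lemma t16P_add {M : Type*} [Monoid M] (φ : ℕ → M) (m m' : ℕ) :
    t16P φ (m + m') = t16P φ m * t16P (fun i => φ (m + i)) m' := by
  induction m' with
  | zero => simp [t16P]
  | succ m' ih => rw [← add_assoc]; simp only [t16P]; rw [ih, mul_assoc]

lemma t16Q_add {M : Type*} [Monoid M] (φ : ℕ → M) (m m' : ℕ) :
    t16Q φ (m + m') = t16Q (fun i => φ (m + i)) m' * t16Q φ m := by
  induction m' with
  | zero => simp [t16Q]
  | succ m' ih => rw [← add_assoc]; simp only [t16Q]; rw [ih, mul_assoc]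

lemma t16PQ {M : Type*} [Monoid M] (φ ψ : ℕ → M) (h : ∀ i, φ i * ψ i = 1) (m : ℕ) :
    t16P φ m * t16Q ψ m = 1 := by
  induction m with
  | zero => simp [t16P, t16Q]
  | succ m ih =>
    simp only [t16P, t16Q]
    rw [mul_assoc, ← mul_assoc (φ m), h, one_mul, ih]

variable {k H : Type} [Field k] [Ring H] [HopfAlgebra k H]

/-- values commute -/
def t16Com {A : Type*} [Ring A] [Algebra k A] (φ ψ : WithConv (H →ₗ[k] A)) : Prop :=
  ∀ x y, Commute (φ x) (ψ y)

lemma t16Com.symm {A : Type*} [Ring A] [Algebra k A] {φ ψ : WithConv (H →ₗ[k] A)}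
    (h : t16Com φ ψ) : t16Com ψ φ := fun x y => (h y x).symm

lemma t16Com.mul_left {A : Type*} [Ring A] [Algebra k A] {φ φ' ψ : WithConv (H →ₗ[k] A)}
    (h : t16Com φ ψ) (h' : t16Com φ' ψ) : t16Com (φ * φ') ψ := by
  intro x y
  rw [(ℛ k x).convMul_apply]
  exact Commute.sum_left _ _ _ fun i _ => (h _ _).mul_left (h' _ _)

lemma t16Com.one_left {A : Type*} [Ring A] [Algebra k A] (ψ : WithConv (H →ₗ[k] A)) :
    t16Com (1 : WithConv (H →ₗ[k] A)) ψ := by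
  intro x y
  exact Algebra.commute_algebraMap_left _ _

lemma t16Com.P_left {A : Type*} [Ring A] [Algebra k A] {φ : ℕ → WithConv (H →ₗ[k] A)}
    {ψ : WithConv (H →ₗ[k] A)} (m : ℕ) (h : ∀ i < m, t16Com (φ i) ψ) : t16Com (t16P φ m) ψ := by
  induction m with
  | zero => exact t16Com.one_left _
  | succ m ih => exact (ih fun i hi => h i (by omega)).mul_left (h m (by omega))

lemma t16Com.Q_left {A : Type*} [Ring A] [Algebra k A] {φ : ℕ → WithConv (H →ₗ[k] A)}
    {ψ : WithConv (H →ₗ[k] A)} (m : ℕ) (h : ∀ i < m, t16Com (φ i) ψ) : t16Com (t16Q φ m) ψ := by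
  induction m with
  | zero => exact t16Com.one_left _
  | succ m ih => exact (h m (by omega)).mul_left (ih fun i hi => h i (by omega))

/-- precomposition with the inverse antipode -/
noncomputable def t16B {A : Type*} [Ring A] [Algebra k A] (Sinv : H →ₗ[k] H)
    (φ : WithConv (H →ₗ[k] A)) : WithConv (H →ₗ[k] A) := toConv (φ.ofConv ∘ₗ Sinv)

lemma t16B_apply {A : Type*} [Ring A] [Algebra k A] (Sinv : H →ₗ[k] H)
    (φ : WithConv (H →ₗ[k] A)) (x : H) : t16B Sinv φ x = φ (Sinv x) := rfl

lemma t16B_one {A : Type*} [Ring A] [Algebra k A] (Sinv : H →ₗ[k] H)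
    (h2 : ∀ h, antipode k (Sinv h) = h) :
    t16B Sinv (1 : WithConv (H →ₗ[k] A)) = 1 := by
  ext x
  change algebraMap k A (counit (Sinv x)) = algebraMap k A (counit x)
  rw [← counit_antipode, h2]

lemma t16B_P {A : Type*} [Ring A] [Algebra k A] (Sinv : H →ₗ[k] H)
    (h1 : ∀ h, Sinv (antipode k h) = h) (h2 : ∀ h, antipode k (Sinv h) = h)
    (φ : ℕ → WithConv (H →ₗ[k] A)) (m : ℕ)
    (h : ∀ i < m, ∀ j < m, i ≠ j → t16Com (φ i) (φ j)) :
    t16B Sinv (t16P φ m) = t16Q (fun i => t16B Sinv (φ i)) m := by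
  induction m with
  | zero => exact t16B_one Sinv h2
  | succ m ih =>
    simp only [t16P, t16Q]
    rw [← ih fun i hi j hj hij => h i (by omega) j (by omega) hij]
    exact t16_conv_Sinv _ _ Sinv h1 h2
      (t16Com.P_left m fun i hi => h i (by omega) m (by omega) (by omega))

lemma t16B_Q {A : Type*} [Ring A] [Algebra k A] (Sinv : H →ₗ[k] H)
    (h1 : ∀ h, Sinv (antipode k h) = h) (h2 : ∀ h, antipode k (Sinv h) = h)
    (φ : ℕ → WithConv (H →ₗ[k] A)) (m : ℕ)
    (h : ∀ i < m, ∀ j < m, i ≠ j → t16Com (φ i) (φ j)) :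
    t16B Sinv (t16Q φ m) = t16P (fun i => t16B Sinv (φ i)) m := by
  induction m with
  | zero => exact t16B_one Sinv h2
  | succ m ih =>
    simp only [t16P, t16Q]
    rw [← ih fun i hi j hj hij => h i (by omega) j (by omega) hij]
    exact t16_conv_Sinv _ _ Sinv h1 h2
      (t16Com.Q_left m fun i hi => h i (by omega) m (by omega) (by omega)).symm

variable {F : Type} [AddCommGroup F] [Module k F]

lemma t16_mul_apply (φ ψ : WithConv (H →ₗ[k] Module.End k F)) (x : H) (g : F) :
    (φ * ψ) x g = ∑ i ∈ (ℛ k x).index, φ ((ℛ k x).left i) (ψ ((ℛ k x).right i) g) := by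
  rw [(ℛ k x).convMul_apply]
  simp [LinearMap.sum_apply]

lemma t16_rep_mul {φ ψ φ' ψ' : WithConv (H →ₗ[k] Module.End k F)} {g : F}
    (h1 : ∀ x, φ x g = φ' x g) (h2 : ∀ x, ψ x g = ψ' x g)
    (c1 : t16Com φ ψ') (c2 : t16Com φ' ψ') (x : H) : (φ * ψ) x g = (φ' * ψ') x g := by
  rw [t16_mul_apply, t16_mul_apply]
  refine Finset.sum_congr rfl fun i _ => ?_
  rw [h2]
  have e1 := congrArg (fun T : Module.End k F => T g)
    (c1 ((ℛ k x).left i) ((ℛ k x).right i)).eq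
  have e2 := congrArg (fun T : Module.End k F => T g)
    (c2 ((ℛ k x).left i) ((ℛ k x).right i)).eq
  simp only [Module.End.mul_apply] at e1 e2
  rw [e1, e2, h1]

lemma t16_rep_Q (φ φ' : ℕ → WithConv (H →ₗ[k] Module.End k F)) (g : F) (m : ℕ)
    (h : ∀ i < m, ∀ x, φ i x g = φ' i x g)
    (c1 : ∀ i < m, ∀ j < m, t16Com (φ i) (φ' j))
    (c2 : ∀ i < m, ∀ j < m, i ≠ j → t16Com (φ' i) (φ' j)) :
    ∀ x, t16Q φ m x g = t16Q φ' m x g := by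
  induction m with
  | zero => intro x; rfl
  | succ m ih =>
    simp only [t16Q]
    apply t16_rep_mul (h m (by omega))
      (ih (fun i hi => h i (by omega)) (fun i hi j hj => c1 i (by omega) j (by omega))
        (fun i hi j hj => c2 i (by omega) j (by omega)))
    · exact (t16Com.Q_left m fun i hi => (c1 m (by omega) i (by omega)).symm).symm
    · exact (t16Com.Q_left m fun i hi => (c2 m (by omega) i (by omega) (by omega)).symm).symm

/-- the scalar-valued convolution element -/
noncomputable def t16S (α : H →ₗ[k] k) : WithConv (H →ₗ[k] Module.End k F) :=
  toConv (Algebra.linearMap k (Module.End k F) ∘ₗ α)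

lemma t16S_apply (α : H →ₗ[k] k) (x : H) (g : F) : t16S (F := F) α x g = α x • g := by
  simp [t16S, Algebra.algebraMap_eq_smul_one]

lemma t16S_com (α : H →ₗ[k] k) (ψ : WithConv (H →ₗ[k] Module.End k F)) : t16Com (t16S (F := F) α) ψ := by
  intro x y
  change Commute (algebraMap k (Module.End k F) (α x)) _
  exact Algebra.commute_algebraMap_left _ _

lemma t16_Om_mul (Ω : F →ₗ[k] k) (φ φ' ψ : WithConv (H →ₗ[k] Module.End k F))
    (h : ∀ x f, Ω (φ x f) = Ω (φ' x f)) (x : H) (f : F) :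
    Ω ((φ * ψ) x f) = Ω ((φ' * ψ) x f) := by
  rw [t16_mul_apply, t16_mul_apply, map_sum, map_sum]
  exact Finset.sum_congr rfl fun i _ => h _ _

theorem t16_core (K k₀ : ℕ)
    (Sinv : H →ₗ[k] H)
    (h1 : ∀ h, Sinv (antipode k h) = h) (h2 : ∀ h, antipode k (Sinv h) = h)
    (α : H →ₗ[k] k) (hα1 : α 1 = 1) (hαm : ∀ a b, α (a * b) = α a * α b)
    (l r lb rb : ℕ → WithConv (H →ₗ[k] Module.End k F)) (Ω : F →ₗ[k] k) (g : F)
    (hl : ∀ i, l i * lb i = 1) (hr : ∀ i, r i * rb i = 1)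
    (hrb : ∀ i x, rb i x = r i (antipode k x))
    (clr : ∀ i j, ∀ x y, Commute (lb i x) (r j y))
    (crr : ∀ i < K + k₀ + (k₀ + 1), ∀ j < K + k₀ + (k₀ + 1), i ≠ j →
      ∀ x y, Commute (r i x) (r j y))
    (hΩl : ∀ x f, Ω (t16P l (K + k₀ + (k₀ + 1)) x f) = counit (R := k) x • Ω f)
    (hΩr : ∀ x f, Ω (t16P r (K + k₀ + (k₀ + 1)) x f) = α x • Ω f)
    (g1 : ∀ i < K, ∀ x, lb (2 * k₀ + 1 + i) x g = r i (Sinv x) g)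
    (g2 : ∀ x, lb (2 * k₀) x g = (t16S (F := F) α * rb (K + 2 * k₀)) x g)
    (g3 : ∀ i < k₀, ∀ x, lb (k₀ + i) x g = rb (K + k₀ + i) x g) (x : H) :
    Ω (t16P l k₀ x g) = Ω (t16P (fun i => r (K + i)) k₀ x g) := by
  have crb : ∀ i < K + k₀ + (k₀ + 1), ∀ j < K + k₀ + (k₀ + 1), i ≠ j → t16Com (rb i) (rb j) := by
    intro i hi j hj hij x y
    rw [hrb, hrb]
    exact crr i hi j hj hij _ _
  have cSr : ∀ i < K + k₀ + (k₀ + 1), ∀ j < K + k₀ + (k₀ + 1), i ≠ j →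
      t16Com (t16B Sinv (r i)) (rb j) := by
    intro i hi j hj hij x y
    rw [hrb, t16B_apply]
    exact crr i hi j hj hij _ _
  have crr' : ∀ i < K + k₀ + (k₀ + 1), ∀ j < K + k₀ + (k₀ + 1), i ≠ j →
      t16Com (r i) (r j) := fun i hi j hj hij x y => crr i hi j hj hij _ _
  have clb : ∀ i j, t16Com (lb i) (rb j) := by
    intro i j x y
    rw [hrb]
    exact clr _ _ _ _
  -- step 1
  have e1 : t16P l k₀ = t16P l (K + k₀ + (k₀ + 1)) *
      t16Q (fun i => lb (k₀ + i)) (k₀ + 1 + K) := by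
    rw [show K + k₀ + (k₀ + 1) = k₀ + (k₀ + 1 + K) by omega, t16P_add, mul_assoc,
      t16PQ _ _ (fun i => hl (k₀ + i)), mul_one]
  have e2 : Ω (t16P l k₀ x g) = Ω (t16Q (fun i => lb (k₀ + i)) (k₀ + 1 + K) x g) := by
    rw [e1, t16_Om_mul Ω _ 1 _ _ x g, one_mul]
    intro x f
    rw [hΩl]
    simp [Algebra.algebraMap_eq_smul_one]
  -- step 2
  have e3 : t16Q (fun i => lb (k₀ + i)) (k₀ + 1 + K) =
      t16Q (fun i => lb (2 * k₀ + 1 + i)) K * (lb (2 * k₀) * t16Q (fun i => lb (k₀ + i)) k₀) := by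
    rw [t16Q_add]
    simp only [t16Q]
    rw [← two_mul]
    congr 3
    funext i
    congr 1
    omega
  have e4 : t16Q (fun i => lb (k₀ + i)) (k₀ + 1 + K) x g =
      (t16Q (fun i => t16B Sinv (r i)) K *
        ((t16S (F := F) α * rb (K + 2 * k₀)) * t16Q (fun i => rb (K + k₀ + i)) k₀)) x g := by
    rw [e3]
    apply t16_rep_mul
    · apply t16_rep_Q
      · intro i hi x
        exact g1 i hi x
      · intro i hi j hj x y
        exact clr _ _ _ _
      · intro i hi j hj hij x y
        exact crr i (by omega) j (by omega) hij _ _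
    · apply t16_rep_mul g2
      · apply t16_rep_Q
        · intro i hi x
          exact g3 i hi x
        · intro i hi j hj
          exact clb _ _
        · intro i hi j hj hij
          exact crb _ (by omega) _ (by omega) (by omega)
      · exact (t16Com.Q_left _ fun i hi => (clb _ _).symm).symm
      · refine (t16Com.Q_left _ fun i hi => ?_).symm
        refine (t16Com.mul_left (t16S_com _ _) ?_).symm
        exact crb _ (by omega) _ (by omega) (by omega)
    · refine t16Com.Q_left _ fun i hi => ?_
      refine (t16Com.mul_left ?_ ?_).symm
      · exact t16Com.mul_left (t16S_com _ _) (clb _ _).symm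
      · exact t16Com.Q_left _ fun i hi => (clb _ _).symm
    · refine t16Com.Q_left _ fun i hi => ?_
      refine (t16Com.mul_left ?_ ?_).symm
      · exact t16Com.mul_left (t16S_com _ _) (cSr _ (by omega) _ (by omega) (by omega)).symm
      · exact t16Com.Q_left _ fun j hj => (cSr _ (by omega) _ (by omega) (by omega)).symm
  -- step 3
  have f1 : t16P r K = t16P r (K + k₀ + (k₀ + 1)) *
      (t16Q (fun i => rb (K + k₀ + i)) (k₀ + 1) * t16Q (fun i => rb (K + i)) k₀) := by
    rw [t16P_add, t16P_add, mul_assoc, ← mul_assoc (t16P (fun i => r (K + k₀ + i)) (k₀ + 1)),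
      t16PQ _ _ (fun i => hr (K + k₀ + i)), one_mul, mul_assoc,
      t16PQ _ _ (fun i => hr (K + i)), mul_one]
  have f2 : ∀ h f, Ω (t16P r K h f) = Ω ((t16S (F := F) α *
      (t16Q (fun i => rb (K + k₀ + i)) (k₀ + 1) * t16Q (fun i => rb (K + i)) k₀)) h f) := by
    intro h f
    rw [f1]
    apply t16_Om_mul
    intro x f
    rw [hΩr, t16S_apply, map_smul]
  have hBrb : ∀ i, t16B Sinv (rb i) = r i := by
    intro i
    ext1
    apply LinearMap.ext
    intro x
    change rb i (Sinv x) = r i x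
    rw [hrb, h2]
  have f3 : t16B Sinv (t16S (F := F) α *
      (t16Q (fun i => rb (K + k₀ + i)) (k₀ + 1) * t16Q (fun i => rb (K + i)) k₀)) =
      t16P (fun i => r (K + i)) k₀ * t16P (fun i => r (K + k₀ + i)) (k₀ + 1) *
        t16B Sinv (t16S (F := F) α) := by
    have a1 := t16_conv_Sinv (t16S (F := F) α)
      (t16Q (fun i => rb (K + k₀ + i)) (k₀ + 1) * t16Q (fun i => rb (K + i)) k₀) Sinv h1 h2
      (t16S_com _ _)
    have a2 := t16_conv_Sinv
      (t16Q (fun i => rb (K + k₀ + i)) (k₀ + 1)) (t16Q (fun i => rb (K + i)) k₀) Sinv h1 h2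
      (t16Com.Q_left _ fun i hi => (t16Com.Q_left _ fun j hj =>
        crb _ (by omega) _ (by omega) (by omega)).symm)
    have a3 := t16B_Q Sinv h1 h2 (fun i => rb (K + k₀ + i)) (k₀ + 1)
      (fun i hi j hj hij => crb _ (by omega) _ (by omega) (by omega))
    have a4 := t16B_Q Sinv h1 h2 (fun i => rb (K + i)) k₀
      (fun i hi j hj hij => crb _ (by omega) _ (by omega) (by omega))
    simp only [hBrb] at a3 a4
    change t16B Sinv _ = t16B Sinv _ * t16B Sinv _ at a1
    change t16B Sinv _ = t16B Sinv _ * t16B Sinv _ at a2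
    rw [a1, a2, a3, a4]
  have f4 : t16B Sinv (t16S (F := F) α) * t16S (F := F) α = 1 := by
    ext x f
    rw [(ℛ k x).convMul_apply]
    have : ∑ i ∈ (ℛ k x).index, α (Sinv ((ℛ k x).left i)) * α ((ℛ k x).right i) =
        counit (R := k) x := by
      have b : ∑ i ∈ (ℛ k x).index, (ℛ k x).right i * Sinv ((ℛ k x).left i) =
          counit (R := k) x • (1 : H) := by
        rw [← h1 (∑ i ∈ (ℛ k x).index, (ℛ k x).right i * Sinv ((ℛ k x).left i)), map_sum]
        simp only [antipode_mul_antidistrib, h2]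
        rw [sum_mul_antipode_eq_smul, map_smul]
        congr 1
        rw [← antipode_one (R := k) (A := H), h1, antipode_one]
      have b2 := congrArg α b
      rw [map_sum, map_smul, hα1] at b2
      simp only [hαm] at b2
      simp only [smul_eq_mul, mul_one] at b2
      rw [← b2]
      exact Finset.sum_congr rfl fun i _ => mul_comm _ _
    rw [LinearMap.convOne_apply, ← this]
    simp [t16B, t16S, Algebra.algebraMap_eq_smul_one, LinearMap.sum_apply, mul_smul]
    exact Finset.sum_congr rfl fun i _ => smul_comm _ _ _
  have f5 : ∀ h f, Ω (t16Q (fun i => t16B Sinv (r i)) K h f) =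
      Ω ((t16P (fun i => r (K + i)) k₀ * t16P (fun i => r (K + k₀ + i)) (k₀ + 1) *
        t16B Sinv (t16S (F := F) α)) h f) := by
    intro h f
    rw [← t16B_P Sinv h1 h2 r K (fun i hi j hj hij => crr' _ (by omega) _ (by omega) hij),
      ← f3, t16B_apply, t16B_apply, f2]
  rw [e2, e4, t16_Om_mul Ω _ _ _ f5]
  have f6 : rb (K + 2 * k₀) * t16Q (fun i => rb (K + k₀ + i)) k₀ =
      t16Q (fun i => rb (K + k₀ + i)) (k₀ + 1) := by
    simp only [t16Q]
    congr 2
    omega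
  rw [mul_assoc (t16S (F := F) α), f6, mul_assoc (t16P (fun i => r (K + i)) k₀ * _), ← mul_assoc (t16B _ _),
    f4, one_mul, mul_assoc, t16PQ _ _ (fun i => hr (K + k₀ + i)), mul_one]

end T16Core
section T16Tensor
open Coalgebra WithConv HopfAlgebra

variable {k H : Type} [Field k] [Ring H] [HopfAlgebra k H]

/-- evaluation of a tuple of linear maps on the nested tensor power, multiplied in `A`. -/
noncomputable def t16PT {A : Type*} [Ring A] [Algebra k A] :
    ∀ (m : ℕ) (_ : ℕ → (H →ₗ[k] A)), Tpow k H m →ₗ[k] A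
  | 0, φ => φ 0
  | m + 1, φ =>
      show TensorProduct k H (Tpow k H m) →ₗ[k] A from
        LinearMap.mul' k A ∘ₗ TensorProduct.map (φ 0) (t16PT m (fun i => φ (1 + i)))

lemma t16PT_nest {A : Type*} [Ring A] [Algebra k A] (m : ℕ) :
    ∀ (φ : ℕ → (H →ₗ[k] A)) (v : Fin (m + 1) → H),
    t16PT m φ (nest k H m v) = (List.ofFn fun i : Fin (m + 1) => φ i (v i)).prod := by
  induction m with
  | zero => intro φ v; simp [t16PT, nest]; rfl
  | succ m ih =>
    intro φ v
    rw [List.ofFn_succ, List.prod_cons]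
    change φ 0 (v 0) * t16PT m (fun i => φ (1 + i)) (nest k H m (fun i => v i.succ)) = _
    rw [ih]
    simp [add_comm]

lemma t16PT_comul {A : Type*} [Ring A] [Algebra k A] (m : ℕ) :
    ∀ (φ : ℕ → WithConv (H →ₗ[k] A)) (x : H),
    t16PT m (fun i => (φ i).ofConv) (comulIter k H m x) = t16P φ (m + 1) x := by
  induction m with
  | zero => intro φ x; simp [t16PT, comulIter, t16P]; rfl
  | succ m ih =>
    intro φ x
    rw [add_comm (m + 1) 1, t16P_add]
    simp only [t16P, one_mul]
    rw [(ℛ k x).convMul_apply]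
    change LinearMap.mul' k A (TensorProduct.map (φ 0).ofConv
      (t16PT m fun i => (φ (1 + i)).ofConv)
      (TensorProduct.map LinearMap.id (comulIter k H m) (comul x))) = _
    conv_lhs => rw [← (ℛ k x).eq]
    simp only [map_sum, TensorProduct.map_tmul, LinearMap.mul'_apply]
    refine Finset.sum_congr rfl fun i _ => ?_
    rw [ih (fun i => φ (1 + i))]
    rfl

lemma t16_e0 (c : H) : Function.update (fun _ : Fin (0 + 1) => (0 : H)) 0 c = fun _ => c := by
  funext i
  rw [Fin.fin_one_eq_zero i]
  simp

lemma t16_ev0_add (f : MultilinearMap k (fun _ : Fin (0 + 1) => H) k) (a b : H) :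
    f (fun _ => a + b) = f (fun _ => a) + f (fun _ => b) := by
  rw [← t16_e0 (a + b), ← t16_e0 a, ← t16_e0 b]
  exact f.map_update_add (fun _ => (0 : H)) 0 a b

lemma t16_ev0_smul (f : MultilinearMap k (fun _ : Fin (0 + 1) => H) k) (a : k) (b : H) :
    f (fun _ => a • b) = a • f (fun _ => b) := by
  rw [← t16_e0 (a • b), ← t16_e0 b]
  exact f.map_update_smul (fun _ => (0 : H)) 0 a b

/-- evaluation of a tensor on multilinear forms -/
noncomputable def t16ev : ∀ (m : ℕ),
    Tpow k H m →ₗ[k] (MultilinearMap k (fun _ : Fin (m + 1) => H) k →ₗ[k] k)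
  | 0 =>
    LinearMap.mk₂ k (fun (a : H) (f : MultilinearMap k (fun _ : Fin (0 + 1) => H) k) =>
        f (fun _ => a))
      (fun a b f => t16_ev0_add f a b) (fun a b f => t16_ev0_smul f a b)
      (by intros; rfl) (by intros; rfl)
  | m + 1 =>
      show TensorProduct k H (Tpow k H m) →ₗ[k] _ from
      TensorProduct.lift (LinearMap.mk₂ k (fun (a : H) (t : Tpow k H m) =>
        (t16ev m t) ∘ₗ ((LinearMap.applyₗ a) ∘ₗ
          (multilinearCurryLeftEquiv k (fun _ : Fin (m + 1 + 1) => H) k).toLinearMap))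
        (by intros; ext; simp) (by intros; ext; simp) (by intros; ext; simp) (by intros; ext; simp))

lemma t16ev_nest (m : ℕ) : ∀ (v : Fin (m + 1) → H)
    (f : MultilinearMap k (fun _ : Fin (m + 1) => H) k), t16ev m (nest k H m v) f = f v := by
  induction m with
  | zero =>
    intro v f
    change f (fun _ => v 0) = f v
    congr 1
    funext i
    rw [Fin.fin_one_eq_zero i]
  | succ m ih =>
    intro v f
    change t16ev m (nest k H m (fun i => v i.succ)) (f.curryLeft (v 0)) = _
    rw [ih]
    rw [MultilinearMap.curryLeft_apply]
    congr 1
    exact Fin.cons_self_tail v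

lemma t16_nest_mul (m : ℕ) : ∀ (v w : Fin (m + 1) → H),
    nest k H m v * nest k H m w = nest k H m (fun i => v i * w i) := by
  induction m with
  | zero => intro v w; rfl
  | succ m ih =>
    intro v w
    change (v 0 ⊗ₜ[k] nest k H m (fun i => v i.succ) : TensorProduct k H (Tpow k H m)) *
      (w 0 ⊗ₜ[k] nest k H m (fun i => w i.succ)) = _
    rw [Algebra.TensorProduct.tmul_mul_tmul, ih]
    rfl

lemma t16_comulIter_mul (m : ℕ) : ∀ a b : H,
    comulIter k H m (a * b) = comulIter k H m a * comulIter k H m b := by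
  induction m with
  | zero => intro a b; rfl
  | succ m ih =>
    intro a b
    have e : ∀ x : H, comulIter k H (m + 1) x =
      (TensorProduct.map LinearMap.id (comulIter k H m)) (comul x) := fun _ => rfl
    have e2 : ∀ s t : H ⊗[k] H,
        (TensorProduct.map (LinearMap.id (R := k) (M := H)) (comulIter k H m)) (s * t) =
        (TensorProduct.map (LinearMap.id (R := k) (M := H)) (comulIter k H m)) s *
        (TensorProduct.map (LinearMap.id (R := k) (M := H)) (comulIter k H m)) t := by
      intro s t
      induction s with
      | zero => simp
      | add s s' h h' => simp only [add_mul, map_add, h, h']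
      | tmul a b =>
        induction t with
        | zero => simp
        | add s s' h h' => simp only [mul_add, map_add, h, h']
        | tmul c d => simp [Algebra.TensorProduct.tmul_mul_tmul, ih]
    rw [e, e, e, Bialgebra.comul_mul, e2]
    rfl

lemma t16_nest_span (m : ℕ) : ∀ t : Tpow k H m, ∃ (q : ℕ) (X : Fin q → Fin (m + 1) → H),
    t = ∑ j, nest k H m (X j) := by
  induction m with
  | zero => intro t; exact ⟨1, fun _ _ => t, by simp [nest]⟩
  | succ m ih =>
    intro t
    change TensorProduct k H (Tpow k H m) at t
    induction t with
    | zero => exact ⟨0, fun _ _ => 0, by simp; rfl⟩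
    | add s s' h h' =>
      obtain ⟨q, X, hX⟩ := h
      obtain ⟨q', X', hX'⟩ := h'
      refine ⟨q + q', Fin.append X X', ?_⟩
      rw [Fin.sum_univ_add]
      simp only [Fin.append_left, Fin.append_right]
      exact congrArg₂ (· + ·) hX hX'
    | tmul a b =>
      obtain ⟨q, X, hX⟩ := ih b
      refine ⟨q, fun j => Fin.cons a (X j), ?_⟩
      rw [hX, TensorProduct.tmul_sum]
      rfl

end T16Tensor

section T16Ops
open Coalgebra WithConv HopfAlgebra

variable (k H : Type) [Field k] [Ring H] [HopfAlgebra k H] (N : ℕ)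

abbrev T16F := MultilinearMap k (fun _ : Fin (N + 1) => H) k

/-- insertion of left multiplication at position `p` -/
noncomputable def t16L (p : Fin (N + 1)) : H →ₗ[k] Module.End k (T16F k H N) :=
  (MultilinearMap.compLinearMapMultilinear.toLinearMap
    (fun _ => (LinearMap.id : H →ₗ[k] H)) p) ∘ₗ (LinearMap.mul k H)

/-- insertion of right multiplication at position `p` -/
noncomputable def t16R (p : Fin (N + 1)) : H →ₗ[k] Module.End k (T16F k H N) :=
  (MultilinearMap.compLinearMapMultilinear.toLinearMap
    (fun _ => (LinearMap.id : H →ₗ[k] H)) p) ∘ₗ (LinearMap.mul k H).flip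

variable {k H N}

lemma t16L_apply (p : Fin (N + 1)) (h : H) (f : T16F k H N) (v : Fin (N + 1) → H) :
    t16L k H N p h f v = f (Function.update v p (h * v p)) := by
  change f (fun i => Function.update (fun _ => (LinearMap.id : H →ₗ[k] H)) p
    (LinearMap.mul k H h) i (v i)) = _
  congr 1
  funext i
  by_cases hi : i = p
  · subst hi; simp
  · simp [hi]

lemma t16R_apply (p : Fin (N + 1)) (h : H) (f : T16F k H N) (v : Fin (N + 1) → H) :
    t16R k H N p h f v = f (Function.update v p (v p * h)) := by
  change f (fun i => Function.update (fun _ => (LinearMap.id : H →ₗ[k] H)) p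
    ((LinearMap.mul k H).flip h) i (v i)) = _
  congr 1
  funext i
  by_cases hi : i = p
  · subst hi; simp
  · simp [hi]

lemma t16LR_comm (p q : Fin (N + 1)) (a b : H) :
    Commute (t16L k H N p a) (t16R k H N q b) := by
  apply LinearMap.ext; intro f
  ext v
  simp only [Module.End.mul_apply, t16L_apply, t16R_apply]
  congr 1
  by_cases h : p = q
  · subst h; simp [mul_assoc]
  · rw [Function.update_of_ne (Ne.symm h), Function.update_of_ne h, Function.update_comm h]

lemma t16LL_comm (p q : Fin (N + 1)) (h : p ≠ q) (a b : H) :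
    Commute (t16L k H N p a) (t16L k H N q b) := by
  apply LinearMap.ext; intro f
  ext v
  simp only [Module.End.mul_apply, t16L_apply]
  congr 1
  rw [Function.update_of_ne (Ne.symm h), Function.update_of_ne h, Function.update_comm h]

lemma t16RR_comm (p q : Fin (N + 1)) (h : p ≠ q) (a b : H) :
    Commute (t16R k H N p a) (t16R k H N q b) := by
  apply LinearMap.ext; intro f
  ext v
  simp only [Module.End.mul_apply, t16R_apply]
  congr 1
  rw [Function.update_of_ne (Ne.symm h), Function.update_of_ne h, Function.update_comm h]

lemma t16L_mul (p : Fin (N + 1)) (a b : H) :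
    t16L k H N p a * t16L k H N p b = t16L k H N p (b * a) := by
  apply LinearMap.ext; intro f
  ext v
  simp [t16L_apply, mul_assoc]

lemma t16R_mul (p : Fin (N + 1)) (a b : H) :
    t16R k H N p a * t16R k H N p b = t16R k H N p (a * b) := by
  apply LinearMap.ext; intro f
  ext v
  simp [t16R_apply, mul_assoc]

lemma t16L_one (p : Fin (N + 1)) : t16L k H N p 1 = 1 := by
  apply LinearMap.ext; intro f
  ext v
  simp [t16L_apply]

lemma t16R_one (p : Fin (N + 1)) : t16R k H N p 1 = 1 := by
  apply LinearMap.ext; intro f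
  ext v
  simp [t16R_apply]

/-- product of left insertions at distinct positions -/
lemma t16L_prod (m : ℕ) : ∀ (e : Fin m → Fin (N + 1)) (_ : Function.Injective e)
    (X : Fin m → H) (f : T16F k H N) (v u : Fin (N + 1) → H)
    (_ : ∀ i, u (e i) = X i * v (e i)) (_ : ∀ p, (∀ i, e i ≠ p) → u p = v p),
    (List.ofFn fun i => t16L k H N (e i) (X i)).prod f v = f u := by
  induction m with
  | zero =>
    intro e _ X f v u _ h2
    have : u = v := funext fun p => h2 p fun i => i.elim0
    simp [this]
  | succ m ih =>
    intro e he X f v u h1 h2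
    rw [List.ofFn_succ, List.prod_cons, Module.End.mul_apply, t16L_apply]
    apply ih (fun i => e i.succ) (fun i j hij => Fin.succ_injective _ (he hij))
    · intro i
      rw [h1, Function.update_of_ne]
      exact fun h => absurd (he h) (Fin.succ_ne_zero i)
    · intro p hp
      by_cases h : p = e 0
      · subst h; simp [h1]
      · rw [Function.update_of_ne h]
        apply h2
        intro i
        refine Fin.cases (fun h' => h h'.symm) (fun i => hp i) i

lemma t16R_prod (m : ℕ) : ∀ (e : Fin m → Fin (N + 1)) (_ : Function.Injective e)
    (X : Fin m → H) (f : T16F k H N) (v u : Fin (N + 1) → H)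
    (_ : ∀ i, u (e i) = v (e i) * X i) (_ : ∀ p, (∀ i, e i ≠ p) → u p = v p),
    (List.ofFn fun i => t16R k H N (e i) (X i)).prod f v = f u := by
  induction m with
  | zero =>
    intro e _ X f v u _ h2
    have : u = v := funext fun p => h2 p fun i => i.elim0
    simp [this]
  | succ m ih =>
    intro e he X f v u h1 h2
    rw [List.ofFn_succ, List.prod_cons, Module.End.mul_apply, t16R_apply]
    apply ih (fun i => e i.succ) (fun i j hij => Fin.succ_injective _ (he hij))
    · intro i
      rw [h1, Function.update_of_ne]
      exact fun h => absurd (he h) (Fin.succ_ne_zero i)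
    · intro p hp
      by_cases h : p = e 0
      · subst h; simp [h1]
      · rw [Function.update_of_ne h]
        apply h2
        intro i
        refine Fin.cases (fun h' => h h'.symm) (fun i => hp i) i

/-- expansion of a convolution product along a representation of the iterated coproduct -/
lemma t16P_rep {A : Type*} [Ring A] [Algebra k A] (m : ℕ) (φ : ℕ → WithConv (H →ₗ[k] A)) (x : H)
    (q : ℕ) (X : Fin q → Fin (m + 1) → H)
    (hX : comulIter k H m x = ∑ j, nest k H m (X j)) :
    t16P φ (m + 1) x = ∑ j, (List.ofFn fun i : Fin (m + 1) => φ i (X j i)).prod := by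
  rw [← t16PT_comul, hX, map_sum]
  simp only [t16PT_nest]

variable (q : ℕ) (Lr : Fin q → Fin (N + 1) → H)

/-- the functional given by the representation -/
noncomputable def t16Om : T16F k H N →ₗ[k] k :=
  t16ev N (∑ i, nest k H N (Lr i))

lemma t16Om_apply (f : T16F k H N) : t16Om q Lr f = ∑ i, f (Lr i) := by
  simp [t16Om, t16ev_nest, LinearMap.sum_apply]

lemma t16_OmL (Λ : H) (hrep : comulIter k H N Λ = ∑ i, nest k H N (Lr i))
    (hΛ : ∀ h : H, h * Λ = Coalgebra.counit (R := k) h • Λ) (x : H) (f : T16F k H N) :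
    t16Om q Lr (t16P (fun i => toConv (t16L k H N (Fin.ofNat (N + 1) i))) (N + 1) x f) =
      counit (R := k) x • t16Om q Lr f := by
  obtain ⟨s, X, hX⟩ := t16_nest_span N (comulIter k H N x)
  have hp := t16P_rep (A := Module.End k (T16F k H N)) N
    (fun i => toConv (t16L k H N (Fin.ofNat (N + 1) i))) x s X hX
  rw [hp, t16Om_apply]
  have e := congrArg (fun t => t16ev N t f) (t16_comulIter_mul (k := k) N x Λ)
  rw [hΛ, map_smul, hX, hrep, Finset.sum_mul_sum] at e
  simp only [t16_nest_mul, map_sum, map_smul, LinearMap.sum_apply, LinearMap.smul_apply,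
    t16ev_nest] at e
  rw [t16Om_apply, e, Finset.sum_comm]
  refine Finset.sum_congr rfl fun i _ => ?_
  rw [LinearMap.sum_apply, sum_apply]
  refine Finset.sum_congr rfl fun j _ => ?_
  have := t16L_prod (k := k) (N + 1) id Function.injective_id (X j) f (Lr i)
    (fun p => X j p * Lr i p) (fun _ => rfl) (fun p hp => absurd rfl (hp p))
  rw [← this]
  simp

lemma t16_OmR (Λ : H) (hrep : comulIter k H N Λ = ∑ i, nest k H N (Lr i))
    (α : H →ₗ[k] k)
    (hα : ∀ h : H, Λ * h = α h • Λ) (x : H) (f : T16F k H N) :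
    t16Om q Lr (t16P (fun i => toConv (t16R k H N (Fin.ofNat (N + 1) i))) (N + 1) x f) =
      α x • t16Om q Lr f := by
  obtain ⟨s, X, hX⟩ := t16_nest_span N (comulIter k H N x)
  have hp := t16P_rep (A := Module.End k (T16F k H N)) N
    (fun i => toConv (t16R k H N (Fin.ofNat (N + 1) i))) x s X hX
  rw [hp, t16Om_apply]
  have e := congrArg (fun t => t16ev N t f) (t16_comulIter_mul (k := k) N Λ x)
  rw [hα, map_smul, hX, hrep, Finset.sum_mul_sum] at e
  simp only [t16_nest_mul, map_sum, map_smul, LinearMap.sum_apply, LinearMap.smul_apply,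
    t16ev_nest] at e
  rw [t16Om_apply, e]
  refine Finset.sum_congr rfl fun i _ => ?_
  rw [LinearMap.sum_apply, sum_apply]
  refine Finset.sum_congr rfl fun j _ => ?_
  have := t16R_prod (k := k) (N + 1) id Function.injective_id (X j) f (Lr i)
    (fun p => Lr i p * X j p) (fun _ => rfl) (fun p hp => absurd rfl (hp p))
  rw [← this]
  simp

end T16Ops
section T16Main
open Coalgebra WithConv HopfAlgebra

variable {k H : Type} [Field k] [Ring H] [HopfAlgebra k H]

/-- the antipode as a unit of the endomorphism ring -/
noncomputable def t16u (Sinv : H →ₗ[k] H)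
    (h1 : ∀ h, Sinv (antipode k h) = h) (h2 : ∀ h, antipode k (Sinv h) = h) :
    (Module.End k H)ˣ :=
  ⟨antipode k, Sinv, LinearMap.ext h2, LinearMap.ext h1⟩

lemma t16_Spow_eq (Sinv : H →ₗ[k] H)
    (h1 : ∀ h, Sinv (antipode k h) = h) (h2 : ∀ h, antipode k (Sinv h) = h)
    (z : ℤ) :
    Spow k H (antipode k) Sinv z = ((t16u Sinv h1 h2 ^ z : (Module.End k H)ˣ) : Module.End k H) := by
  unfold Spow
  split_ifs with h
  · obtain ⟨m, rfl⟩ := Int.eq_ofNat_of_zero_le h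
    simp [t16u]
  · obtain ⟨m, rfl⟩ : ∃ m : ℕ, z = -(m : ℤ) := ⟨(-z).toNat, by omega⟩
    simp [t16u]

lemma t16_Spow_add (Sinv : H →ₗ[k] H)
    (h1 : ∀ h, Sinv (antipode k h) = h) (h2 : ∀ h, antipode k (Sinv h) = h)
    (a b : ℤ) (h : H) :
    Spow k H (antipode k) Sinv (a + b) h =
      Spow k H (antipode k) Sinv a (Spow k H (antipode k) Sinv b h) := by
  rw [t16_Spow_eq Sinv h1 h2, t16_Spow_eq Sinv h1 h2, t16_Spow_eq Sinv h1 h2, zpow_add]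
  rfl

lemma t16_Spow_zero (Sinv : H →ₗ[k] H) (h : H) : Spow k H (antipode k) Sinv 0 h = h := by
  simp [Spow]

lemma t16_Spow_two (Sinv : H →ₗ[k] H) (h : H) : Spow k H (antipode k) Sinv 2 h = antipode k (antipode k h) := by
  simp [Spow, pow_two]

lemma t16_Spow_neg_two (Sinv : H →ₗ[k] H) (h : H) : Spow k H (antipode k) Sinv (-2) h = Sinv (Sinv h) := by
  simp [Spow, pow_two]

lemma t16_Spow_succ (Sinv : H →ₗ[k] H)
    (h1 : ∀ h, Sinv (antipode k h) = h) (h2 : ∀ h, antipode k (Sinv h) = h)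
    (c : ℤ) (h : H) :
    Spow k H (antipode k) Sinv (2 * (c + 1)) h =
      Spow k H (antipode k) Sinv (2 * c) (antipode k (antipode k h)) := by
  rw [mul_add, mul_one, t16_Spow_add Sinv h1 h2, t16_Spow_two Sinv]

lemma t16_Spow_mul (Sinv : H →ₗ[k] H)
    (h1 : ∀ h, Sinv (antipode k h) = h) (h2 : ∀ h, antipode k (Sinv h) = h)
    (c : ℤ) : ∀ (a b : H),
    Spow k H (antipode k) Sinv (2 * c) (a * b) =
      Spow k H (antipode k) Sinv (2 * c) a * Spow k H (antipode k) Sinv (2 * c) b := by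
  induction c using Int.induction_on with
  | zero => intro a b; simp [t16_Spow_zero Sinv]
  | succ c ih =>
    intro a b
    simp only [t16_Spow_succ Sinv h1 h2, HopfAlgebra.antipode_mul_antidistrib, ih]
  | pred c ih =>
    intro a b
    have e : (2 * (-(c : ℤ) - 1)) = 2 * (-c) + (-2) := by ring
    simp only [e, t16_Spow_add Sinv h1 h2, t16_Spow_neg_two Sinv,
      t16_Sinv_mul Sinv h1 h2, ih]

lemma t16_list {M : Type*} [Monoid M] (n : ℕ) : ∀ (g g' : Fin n → M) (t : ℕ) (ht : t + 1 < n)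
    (_ : ∀ i : Fin n, (i : ℕ) ≠ t → (i : ℕ) ≠ t + 1 → g i = g' i)
    (_ : g ⟨t, by omega⟩ * g ⟨t + 1, ht⟩ = g' ⟨t, by omega⟩ * g' ⟨t + 1, ht⟩),
    (List.ofFn g).prod = (List.ofFn g').prod := by
  induction n with
  | zero => intro g g' t ht; omega
  | succ n ih =>
    intro g g' t ht h h'
    rw [List.ofFn_succ, List.ofFn_succ, List.prod_cons, List.prod_cons]
    cases t with
    | zero =>
      obtain ⟨n, rfl⟩ : ∃ n', n = n' + 1 := ⟨n - 1, by omega⟩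
      rw [List.ofFn_succ, List.ofFn_succ, List.prod_cons, List.prod_cons, ← mul_assoc, ← mul_assoc]
      congr 1
      congr 2
      funext i
      apply h
      · simp
      · simp
    | succ t =>
      rw [h 0 (by simp) (by simp)]
      congr 1
      apply ih _ _ t (by omega)
      · intro i hi hi'
        apply h
        · simpa using hi
        · simpa using hi'
      · exact h'

variable {N : ℕ}

/-- the basic multilinear form -/
noncomputable def t16f0 (lam : H →ₗ[k] k) (D : Fin (N + 1) → (H →ₗ[k] H))
    (σ : Equiv.Perm (Fin (N + 1))) : T16F k H N :=
  (lam ∘ₗ (antipode k : H →ₗ[k] H)).compMultilinearMap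
    (((MultilinearMap.mkPiAlgebraFin k (N + 1) H).compLinearMap
      (fun t => D (σ t))).domDomCongr σ)

lemma t16f0_apply (lam : H →ₗ[k] k) (D : Fin (N + 1) → (H →ₗ[k] H))
    (σ : Equiv.Perm (Fin (N + 1))) (v : Fin (N + 1) → H) :
    t16f0 lam D σ v =
      lam (antipode k (List.ofFn fun t => D (σ t) (v (σ t))).prod) := by
  simp [t16f0]

lemma t16_nbr (lam : H →ₗ[k] k) (D : Fin (N + 1) → (H →ₗ[k] H))
    (hD : ∀ p a b, D p (a * b) = D p a * D p b)
    (σ : Equiv.Perm (Fin (N + 1))) (p q : Fin (N + 1))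
    (hpq : (σ.symm p : ℕ) = σ.symm q + 1) (y z : H) (hyz : D p y = D q z) :
    t16L k H N p y (t16f0 lam D σ) = t16R k H N q z (t16f0 lam D σ) := by
  have hne : p ≠ q := by rintro rfl; omega
  ext v
  rw [t16L_apply, t16R_apply, t16f0_apply, t16f0_apply]
  congr 2
  have hlt := (σ.symm p).isLt
  have e1 : (⟨(σ.symm q : ℕ), by omega⟩ : Fin (N + 1)) = σ.symm q := rfl
  have e2 : (⟨(σ.symm q : ℕ) + 1, by omega⟩ : Fin (N + 1)) = σ.symm p := Fin.ext hpq.symm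
  apply t16_list (N + 1) _ _ (σ.symm q : ℕ) (by omega)
  · intro i hi hi'
    have n1 : σ i ≠ q := by rintro rfl; simp at hi
    have n2 : σ i ≠ p := by rintro rfl; simp at hi' hpq; omega
    simp [n1, n2]
  · rw [e1, e2]
    simp [hne, hne.symm, hD, hyz, mul_assoc]

lemma t16_ends [FiniteDimensional k H] (Sinv : H →ₗ[k] H)
    (h1 : ∀ h, Sinv (antipode k h) = h) (h2 : ∀ h, antipode k (Sinv h) = h)
    (lam : H →ₗ[k] k) (Λ : H)
    (hΛ : ∀ h : H, h * Λ = Coalgebra.counit (R := k) h • Λ)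
    (hlam : ∀ h : H,
      (TensorProduct.lid k H) ((TensorProduct.map lam LinearMap.id)
        (Coalgebra.comul (R := k) h)) = lam h • (1 : H))
    (hnorm : lam Λ = 1)
    (α : H →ₗ[k] k) (hα : ∀ h : H, Λ * h = α h • Λ)
    (D : Fin (N + 1) → (H →ₗ[k] H))
    (σ : Equiv.Perm (Fin (N + 1))) (hD0 : ∀ a, D (σ 0) a = a)
    (hD1 : ∀ a, D (σ (Fin.last N)) a = a) (h : H) :
    t16L k H N (σ 0) (Sinv h) (t16f0 lam D σ) = ∑ i ∈ (ℛ k h).index,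
      α ((ℛ k h).left i) • t16R k H N (σ (Fin.last N)) (antipode k ((ℛ k h).right i))
        (t16f0 lam D σ) := by
  ext v
  rw [sum_apply, t16L_apply, t16f0_apply]
  have e1 : (List.ofFn fun t => D (σ t) (Function.update v (σ 0) (Sinv h * v (σ 0)) (σ t))).prod =
      Sinv h * (List.ofFn fun t => D (σ t) (v (σ t))).prod := by
    rw [List.ofFn_succ, List.ofFn_succ, List.prod_cons, List.prod_cons]
    simp [hD0, mul_assoc]
  have e2 : ∀ z : H, (List.ofFn fun t => D (σ t) (Function.update v (σ (Fin.last N))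
      (v (σ (Fin.last N)) * z) (σ t))).prod =
      (List.ofFn fun t => D (σ t) (v (σ t))).prod * z := by
    intro z
    rw [List.ofFn_succ', List.ofFn_succ', List.concat_eq_append, List.concat_eq_append,
      List.prod_append, List.prod_append]
    have : ∀ i : Fin N, i.castSucc ≠ Fin.last N := fun i => (Fin.castSucc_lt_last i).ne
    simp [hD1, mul_assoc, this]
  rw [e1, HopfAlgebra.antipode_mul_antidistrib, h2, t16_radford Sinv h1 h2 lam Λ hΛ hlam hnorm α hα]
  refine Finset.sum_congr rfl fun i _ => ?_
  rw [smul_apply, t16R_apply, t16f0_apply, e2, HopfAlgebra.antipode_mul_antidistrib]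

lemma t16_swap {F : Type*} [AddCommGroup F] [Module k F] (f : F) (m : ℕ) :
    ∀ (A B : Fin m → Module.End k F) (_ : ∀ i, A i f = B i f)
    (_ : ∀ i j, Commute (A i) (B j)) (_ : ∀ i j, i ≠ j → Commute (B i) (B j)),
    (List.ofFn A).prod f = (List.ofFn B).prod f := by
  induction m with
  | zero => intros; simp
  | succ m ih =>
    intro A B h c1 c2
    rw [List.ofFn_succ, List.ofFn_succ, List.prod_cons, List.prod_cons]
    have e := ih (fun i => A i.succ) (fun i => B i.succ) (fun i => h _) (fun i j => c1 _ _)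
      (fun i j hij => c2 _ _ (fun h => hij (Fin.succ_injective _ h)))
    have a1 : Commute (A 0) (List.ofFn fun i => B i.succ).prod := by
      apply Commute.list_prod_right
      intro y hy
      obtain ⟨i, rfl⟩ := (List.mem_ofFn' _ _).1 hy
      exact c1 _ _
    have a2 : Commute (B 0) (List.ofFn fun i => B i.succ).prod := by
      apply Commute.list_prod_right
      intro y hy
      obtain ⟨i, rfl⟩ := (List.mem_ofFn' _ _).1 hy
      exact c2 _ _ (Fin.succ_ne_zero i).symm
    rw [Module.End.mul_apply, e, ← Module.End.mul_apply, a1.eq, a2.eq, Module.End.mul_apply,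
      Module.End.mul_apply, h]

lemma t16_perm {n K : ℕ} (hKn : K < n) (hn : n = N + 1) (σ : Equiv.Perm (Fin (N + 1)))
    (hσ : ∀ t : Fin (N + 1), ((σ t : ℕ) + 1 + ((t : ℕ) + 1) * K) % n = 0)
    (p q : Fin (N + 1)) (hp : (p : ℕ) + 1 + K ≠ n)
    (hq : (q : ℕ) = p + K ∨ (q : ℕ) + n = p + K) :
    (σ.symm p : ℕ) = σ.symm q + 1 := by
  subst hn
  have hpl := p.isLt
  have hql := q.isLt
  have h0 := hσ (σ.symm p)
  rw [Equiv.apply_symm_apply] at h0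
  obtain ht | ⟨s, hs⟩ : (σ.symm p : ℕ) = 0 ∨ ∃ s, (σ.symm p : ℕ) = s + 1 := by
    rcases (σ.symm p : ℕ) with _ | s
    · exact Or.inl rfl
    · exact Or.inr ⟨s, rfl⟩
  · rw [ht, zero_add, one_mul] at h0
    obtain ⟨a, ha⟩ := Nat.dvd_of_mod_eq_zero h0
    exfalso
    apply hp
    have : a < 2 := by
      by_contra hh
      have := Nat.mul_le_mul_left (N + 1) (not_lt.1 hh)
      omega
    interval_cases a <;> omega
  · have hlt := (σ.symm p).isLt
    have h1 := hσ ⟨s, by omega⟩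
    simp only at h1
    rw [hs] at h0
    have key : ((σ ⟨s, by omega⟩ : Fin (N + 1)) : ℕ) ≡ q [MOD (N + 1)] := by
      have e : ((σ ⟨s, by omega⟩ : Fin (N + 1)) : ℕ) + (1 + (s + 1) * K) ≡
          (p + K) + (1 + (s + 1) * K) [MOD (N + 1)] := by
        unfold Nat.ModEq
        rw [← add_assoc, h1, ← h0]
        congr 1
        ring
      have e' := Nat.ModEq.add_right_cancel' _ e
      rcases hq with hq | hq
      · rw [hq]; exact e'
      · rw [← hq] at e'
        exact e'.trans (by simp [Nat.ModEq])
    have : σ ⟨s, by omega⟩ = q :=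
      Fin.ext (Nat.ModEq.eq_of_lt_of_lt key (Fin.isLt _) q.isLt)
    rw [← this, hs]
    simp

lemma t16_perm0 {K : ℕ} (hKn : K < N + 1) (σ : Equiv.Perm (Fin (N + 1)))
    (hσ : ∀ t : Fin (N + 1), ((σ t : ℕ) + 1 + ((t : ℕ) + 1) * K) % (N + 1) = 0) :
    (σ 0 : ℕ) + 1 + K = N + 1 := by
  have h0 := hσ 0
  have := (σ 0).isLt
  rw [Fin.val_zero, zero_add, one_mul] at h0
  obtain ⟨a, ha⟩ := Nat.dvd_of_mod_eq_zero h0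
  have : a < 2 := by
    by_contra hh
    have := Nat.mul_le_mul_left (N + 1) (not_lt.1 hh)
    omega
  interval_cases a <;> omega

lemma t16_permN {K : ℕ} (σ : Equiv.Perm (Fin (N + 1)))
    (hσ : ∀ t : Fin (N + 1), ((σ t : ℕ) + 1 + ((t : ℕ) + 1) * K) % (N + 1) = 0) :
    σ (Fin.last N) = Fin.last N := by
  have h0 := hσ (Fin.last N)
  have hl := (σ (Fin.last N)).isLt
  rw [Fin.val_last, Nat.add_mul_mod_self_left] at h0
  obtain ⟨a, ha⟩ := Nat.dvd_of_mod_eq_zero h0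
  apply Fin.ext
  rw [Fin.val_last]
  have : a < 2 := by
    by_contra hh
    have := Nat.mul_le_mul_left (N + 1) (not_lt.1 hh)
    omega
  interval_cases a <;> omega

lemma t16_lpr (a b n : ℕ) (h : a + 1 ≤ n) (hb : b = a + 1 + n) : lpr b n = a + 1 := by
  subst hb
  unfold lpr
  have e : a + 1 + n + n - 1 = a + n + n := by omega
  rw [e, Nat.add_mod_right, Nat.add_mod_right, Nat.mod_eq_of_lt (by omega)]

lemma t16_aconv {A : Type*} [Ring A] [Algebra k A] (T : H →ₗ[k] A)
    (hT : ∀ a b, T a * T b = T (b * a)) (hT1 : T 1 = 1) (Sinv : H →ₗ[k] H)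
    (h1 : ∀ h, Sinv (antipode k h) = h) (h2 : ∀ h, antipode k (Sinv h) = h) :
    toConv T * toConv (T ∘ₗ Sinv) = 1 := by
  apply WithConv.ofConv_injective
  apply LinearMap.ext
  intro x
  obtain ⟨y, rfl⟩ : ∃ y, x = antipode k y := ⟨Sinv x, (h2 x).symm⟩
  have e := t16_conv_antipode (toConv T) (toConv (T ∘ₗ Sinv)) y
  rw [e]
  have e : ∀ i, (toConv T) (antipode k ((ℛ k y).right i)) *
      (toConv (T ∘ₗ Sinv)) (antipode k ((ℛ k y).left i)) =
      T ((ℛ k y).left i * antipode k ((ℛ k y).right i)) := by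
    intro i
    rw [← hT]
    simp [h1]
  simp only [e]
  rw [← map_sum, sum_mul_antipode_eq_algebraMap_counit, Algebra.algebraMap_eq_smul_one, map_smul,
    hT1]
  simp [LinearMap.convOne_def, Algebra.algebraMap_eq_smul_one]

lemma t16_lconv (p : Fin (N + 1)) (Sinv : H →ₗ[k] H)
    (h1 : ∀ h, Sinv (antipode k h) = h) (h2 : ∀ h, antipode k (Sinv h) = h) :
    toConv (t16L k H N p) * toConv (t16L k H N p ∘ₗ Sinv) = 1 := by
  have h := t16_aconv (A := Module.End k (T16F k H N)) (t16L k H N p) (t16L_mul p) (t16L_one p)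
    Sinv h1 h2
  convert h

lemma t16_hconv {A : Type*} [Ring A] [Algebra k A] (T : H →ₗ[k] A)
    (hT : ∀ a b, T a * T b = T (a * b)) (hT1 : T 1 = 1) :
    toConv T * toConv (T ∘ₗ antipode k) = 1 := by
  apply WithConv.ofConv_injective
  apply LinearMap.ext
  intro y
  have e := (ℛ k y).convMul_apply (toConv T) (toConv (T ∘ₗ antipode k))
  rw [e]
  have e : ∀ i, (toConv T) ((ℛ k y).left i) *
      (toConv (T ∘ₗ antipode k)) ((ℛ k y).right i) =
      T ((ℛ k y).left i * antipode k ((ℛ k y).right i)) := by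
    intro i
    rw [← hT]
    simp
  simp only [e]
  rw [← map_sum, sum_mul_antipode_eq_algebraMap_counit, Algebra.algebraMap_eq_smul_one, map_smul,
    hT1]
  simp [LinearMap.convOne_def, Algebra.algebraMap_eq_smul_one]

lemma t16_rconv (p : Fin (N + 1)) :
    toConv (t16R k H N p) * toConv (t16R k H N p ∘ₗ antipode k) = 1 := by
  have h := t16_hconv (A := Module.End k (T16F k H N)) (t16R k H N p) (t16R_mul p) (t16R_one p)
  convert h
/-- product of the left insertions of `w` -/
noncomputable def t16W {m : ℕ} (w : Fin m → H) : Module.End k (T16F k H N) :=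
  (List.ofFn fun i : Fin m => t16L k H N (Fin.ofNat (N + 1) i) (w i)).prod

lemma t16W_comR {m : ℕ} (w : Fin m → H) (q : Fin (N + 1)) (y : H) (f : T16F k H N) :
    t16R k H N q y (t16W w f) = t16W w (t16R k H N q y f) := by
  have a1 : Commute (t16R k H N q y) (t16W w) := by
    apply Commute.list_prod_right
    intro z hz
    obtain ⟨i, rfl⟩ := (List.mem_ofFn' _ _).1 hz
    exact (t16LR_comm _ _ _ _).symm
  have := congrArg (fun T : Module.End k (T16F k H N) => T f) a1.eq
  exact this

lemma t16W_comL {m : ℕ} (w : Fin m → H) (hm : m ≤ N + 1) (q : Fin (N + 1)) (hq : m ≤ (q : ℕ))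
    (y : H) (f : T16F k H N) :
    t16L k H N q y (t16W w f) = t16W w (t16L k H N q y f) := by
  have a1 : Commute (t16L k H N q y) (t16W w) := by
    apply Commute.list_prod_right
    intro z hz
    obtain ⟨i, rfl⟩ := (List.mem_ofFn' _ _).1 hz
    apply t16LL_comm
    intro h
    have h' := congrArg Fin.val h
    rw [Fin.val_ofNat, Nat.mod_eq_of_lt (by omega)] at h'
    omega
  have := congrArg (fun T : Module.End k (T16F k H N) => T f) a1.eq
  exact this

lemma t16W_comRprod {m m' : ℕ} (w : Fin m → H) (e : Fin m' → Fin (N + 1)) (y : Fin m' → H)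
    (f : T16F k H N) :
    (List.ofFn fun i => t16R k H N (e i) (y i)).prod (t16W w f) =
      t16W w ((List.ofFn fun i => t16R k H N (e i) (y i)).prod f) := by
  have a1 : Commute ((List.ofFn fun i => t16R k H N (e i) (y i)).prod) (t16W w) := by
    apply Commute.list_prod_left
    intro z hz
    obtain ⟨i, rfl⟩ := (List.mem_ofFn' _ _).1 hz
    apply Commute.list_prod_right
    intro z hz
    obtain ⟨j, rfl⟩ := (List.mem_ofFn' _ _).1 hz
    exact (t16LR_comm _ _ _ _).symm
  have := congrArg (fun T : Module.End k (T16F k H N) => T f) a1.eq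
  exact this

/-- the key equality in terms of operators -/
lemma t16_key [FiniteDimensional k H]
    (Sinv : H →ₗ[k] H)
    (h1 : ∀ h, Sinv (antipode k h) = h) (h2 : ∀ h, antipode k (Sinv h) = h)
    (lam : H →ₗ[k] k) (Λ : H)
    (hΛ : ∀ h : H, h * Λ = Coalgebra.counit (R := k) h • Λ)
    (hlam : ∀ h : H,
      (TensorProduct.lid k H) ((TensorProduct.map lam LinearMap.id)
        (Coalgebra.comul (R := k) h)) = lam h • (1 : H))
    (hnorm : lam Λ = 1)
    (α : H →ₗ[k] k) (hα : ∀ h : H, Λ * h = α h • Λ)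
    (K k₀ : ℕ) (hK : 0 < K) (hN : N = K + 2 * k₀)
    (c : ℕ → ℤ) (hc : IsCSeq (N + 1) K c)
    (σ : Equiv.Perm (Fin (N + 1)))
    (hσ : ∀ t : Fin (N + 1), ((σ t : ℕ) + 1 + ((t : ℕ) + 1) * K) % (N + 1) = 0)
    (w : Fin k₀ → H) (m₁ : ℕ) (Lr : Fin m₁ → Fin (N + 1) → H)
    (hrep : comulIter k H N Λ = ∑ i, nest k H N (Lr i))
    (D : Fin (N + 1) → (H →ₗ[k] H))
    (hDdef : ∀ p : Fin (N + 1), D p = Spow k H (antipode k) Sinv (2 * c ((p : ℕ) + 1)))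
    (x : H) :
    t16Om m₁ Lr (t16P (fun i => toConv (t16L k H N (Fin.ofNat (N + 1) i))) k₀ x
        (t16W w (t16f0 lam D σ))) =
      t16Om m₁ Lr (t16P (fun i => toConv (t16R k H N (Fin.ofNat (N + 1) (K + i)))) k₀ x
        (t16W w (t16f0 lam D σ))) := by
  obtain ⟨hc0, hc1, hc2, hc3⟩ := hc
  have hk : (N + 1 - K - 1) / 2 = k₀ := by omega
  rw [hk] at hc1 hc2 hc3
  have hv : ∀ i, i < N + 1 → ((Fin.ofNat (N + 1) i : Fin (N + 1)) : ℕ) = i := by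
    intro i hi
    rw [Fin.val_ofNat, Nat.mod_eq_of_lt hi]
  have hD : ∀ p a b, D p (a * b) = D p a * D p b := by
    intro p a b
    rw [hDdef]
    exact t16_Spow_mul Sinv h1 h2 _ a b
  have hΛ0 : Λ ≠ 0 := by
    rintro rfl
    simp at hnorm
  have hN1 : K + k₀ + (k₀ + 1) = N + 1 := by omega
  have hσ0 : σ 0 = Fin.ofNat (N + 1) (2 * k₀) := by
    apply Fin.ext
    rw [hv _ (by omega)]
    have := t16_perm0 (by omega) σ hσ
    omega
  have hσN : σ (Fin.last N) = Fin.ofNat (N + 1) (K + 2 * k₀) := by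
    rw [t16_permN σ hσ]
    apply Fin.ext
    rw [hv _ (by omega), Fin.val_last, hN]
  have c0 : c (2 * k₀ + 1) = 0 := by
    have := hc3 (2 * k₀ + 1) (by omega) (by omega)
    rw [← this, ← hc0]
    congr 1
    unfold lpr
    rw [show 2 * k₀ + 1 + K + (N + 1) - 1 = N + (N + 1) by omega, Nat.add_mod_right,
      Nat.mod_eq_of_lt (by omega)]
  refine t16_core (F := T16F k H N) K k₀ Sinv h1 h2 α ?_ ?_
    (fun i => toConv (t16L k H N (Fin.ofNat (N + 1) i)))
    (fun i => toConv (t16R k H N (Fin.ofNat (N + 1) i)))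
    (fun i => toConv (t16L k H N (Fin.ofNat (N + 1) i) ∘ₗ Sinv))
    (fun i => toConv (t16R k H N (Fin.ofNat (N + 1) i) ∘ₗ antipode k))
    (t16Om m₁ Lr) (t16W w (t16f0 lam D σ)) ?_ ?_ ?_ ?_ ?_ ?_ ?_ ?_ ?_ ?_ x
  · have := hα 1
    rw [mul_one] at this
    have h3 : (1 : k) • Λ = α 1 • Λ := by rw [one_smul]; exact this
    exact (smul_left_injective k hΛ0 h3).symm
  · intro a b
    have : α (a * b) • Λ = (α a * α b) • Λ := by
      rw [← hα, ← mul_assoc, hα, smul_mul_assoc, hα, smul_smul]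
    exact smul_left_injective k hΛ0 this
  · intro i
    exact t16_lconv _ Sinv h1 h2
  · intro i
    exact t16_rconv _
  · intro i x
    rfl
  · intro i j x y
    exact t16LR_comm _ _ _ _
  · intro i hi j hj hij x y
    apply t16RR_comm
    intro h
    apply hij
    have h' := congrArg Fin.val h
    rwa [hv _ (by omega), hv _ (by omega)] at h'
  · intro x f
    rw [hN1]
    exact t16_OmL m₁ Lr Λ hrep hΛ x f
  · intro x f
    rw [hN1]
    exact t16_OmR m₁ Lr Λ hrep α hα x f
  · intro i hi x
    change t16L k H N (Fin.ofNat (N + 1) (2 * k₀ + 1 + i)) (Sinv x) _ =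
      t16R k H N (Fin.ofNat (N + 1) i) (Sinv x) _
    rw [t16W_comR, t16W_comL w (by omega) _ (by rw [hv _ (by omega)]; omega)]
    congr 1
    apply t16_nbr lam D hD
    · apply t16_perm (n := N + 1) (K := K) (by omega) rfl σ hσ
      · rw [hv _ (by omega)]; omega
      · rw [hv _ (by omega), hv _ (by omega)]; omega
    · rw [hDdef, hDdef, hv _ (by omega), hv _ (by omega)]
      have := hc3 (2 * k₀ + 1 + i + 1) (by omega) (by omega)
      rw [t16_lpr i _ (N + 1) (by omega) (by omega)] at this
      rw [this]
  · intro x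
    rw [t16_mul_apply]
    change t16L k H N (Fin.ofNat (N + 1) (2 * k₀)) (Sinv x) _ = _
    rw [t16W_comL w (by omega) _ (by rw [hv _ (by omega)]; omega), ← hσ0,
      t16_ends Sinv h1 h2 lam Λ hΛ hlam hnorm α hα D σ, map_sum]
    · refine Finset.sum_congr rfl fun i _ => ?_
      rw [t16S_apply, map_smul, ← t16W_comR, ← hσN]
      rfl
    · intro a
      rw [hσ0, hDdef, hv _ (by omega), c0, mul_zero, t16_Spow_zero]
    · intro a
      rw [hσN, hDdef, hv _ (by omega), ← hN, hc0, mul_zero, t16_Spow_zero]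
  · intro i hi x
    change t16L k H N (Fin.ofNat (N + 1) (k₀ + i)) (Sinv x) _ =
      t16R k H N (Fin.ofNat (N + 1) (K + k₀ + i)) (antipode k x) _
    rw [t16W_comR, t16W_comL w (by omega) _ (by rw [hv _ (by omega)]; omega)]
    congr 1
    apply t16_nbr lam D hD
    · apply t16_perm (n := N + 1) (K := K) (by omega) rfl σ hσ
      · rw [hv _ (by omega)]; omega
      · rw [hv _ (by omega), hv _ (by omega)]; omega
    · rw [hDdef, hDdef, hv _ (by omega), hv _ (by omega)]
      have := hc2 (k₀ + i + 1) (by omega) (by omega)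
      rw [show k₀ + i + 1 + K = K + k₀ + i + 1 by omega] at this
      rw [show c (k₀ + i + 1) = c (K + k₀ + i + 1) + 1 by omega, t16_Spow_succ Sinv h1 h2, h2]
lemma t16_main [FiniteDimensional k H]
    (Sinv : H →ₗ[k] H)
    (h1 : ∀ h, Sinv (antipode k h) = h) (h2 : ∀ h, antipode k (Sinv h) = h)
    (lam : H →ₗ[k] k) (Λ : H)
    (hΛ : ∀ h : H, h * Λ = Coalgebra.counit (R := k) h • Λ)
    (hlam : ∀ h : H,
      (TensorProduct.lid k H) ((TensorProduct.map lam LinearMap.id)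
        (Coalgebra.comul (R := k) h)) = lam h • (1 : H))
    (hnorm : lam Λ = 1)
    (α : H →ₗ[k] k) (hα : ∀ h : H, Λ * h = α h • Λ)
    (K m : ℕ) (hK : 0 < K) (hN : N = K + 2 * (m + 1))
    (c : ℕ → ℤ) (hc : IsCSeq (N + 1) K c)
    (σ : Equiv.Perm (Fin (N + 1)))
    (hσ : ∀ t : Fin (N + 1), ((σ t : ℕ) + 1 + ((t : ℕ) + 1) * K) % (N + 1) = 0)
    (x : H) (w : Fin (m + 1) → H) (m₁ : ℕ) (L : Fin m₁ → Fin (N + 1) → H)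
    (hrep : comulIter k H N Λ = ∑ i, nest k H N (L i))
    (m₂ : ℕ) (X : Fin m₂ → Fin (m + 1) → H)
    (hrepx : comulIter k H m x = ∑ j, nest k H m (X j)) :
    (∑ i, ∑ j, lam (antipode k ((List.ofFn (fun t : Fin (N + 1) =>
        (fun ℓ : Fin (N + 1) =>
          if hℓ : (ℓ : ℕ) < m + 1 then
            Spow k H (antipode k) Sinv (2 * c ((ℓ : ℕ) + 1))
              (w ⟨(ℓ : ℕ), hℓ⟩ * X j ⟨(ℓ : ℕ), hℓ⟩ * L i ℓ)
          else
            Spow k H (antipode k) Sinv (2 * c ((ℓ : ℕ) + 1)) (L i ℓ)) (σ t))).prod))) =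
    (∑ i, ∑ j, lam (antipode k ((List.ofFn (fun t : Fin (N + 1) =>
        (fun ℓ : Fin (N + 1) =>
          if hℓ : (ℓ : ℕ) < m + 1 then
            Spow k H (antipode k) Sinv (2 * c ((ℓ : ℕ) + 1))
              (antipode k (antipode k (X j ⟨(ℓ : ℕ), hℓ⟩)) * w ⟨(ℓ : ℕ), hℓ⟩ * L i ℓ)
          else
            Spow k H (antipode k) Sinv (2 * c ((ℓ : ℕ) + 1)) (L i ℓ)) (σ t))).prod))) := by
  let D : Fin (N + 1) → (H →ₗ[k] H) :=
    fun p => Spow k H (antipode k) Sinv (2 * c ((p : ℕ) + 1))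
  have key := t16_key Sinv h1 h2 lam Λ hΛ hlam hnorm α hα K (m + 1) hK hN c hc σ hσ w m₁ L hrep
    D (fun _ => rfl) x
  have hp := t16P_rep (A := Module.End k (T16F k H N)) m
    (fun i => toConv (t16L k H N (Fin.ofNat (N + 1) i))) x m₂ X hrepx
  have hq := t16P_rep (A := Module.End k (T16F k H N)) m
    (fun i => toConv (t16R k H N (Fin.ofNat (N + 1) (K + i)))) x m₂ X hrepx
  rw [hp, hq, t16Om_apply, t16Om_apply] at key
  have hv : ∀ i, i < N + 1 → ((Fin.ofNat (N + 1) i : Fin (N + 1)) : ℕ) = i := by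
    intro i hi
    rw [Fin.val_ofNat, Nat.mod_eq_of_lt hi]
  let e : Fin (m + 1) → Fin (N + 1) := fun i => Fin.ofNat (N + 1) i
  have hev : ∀ i, (e i : ℕ) = i := fun i => hv _ (by omega)
  have he : Function.Injective e := by
    intro i j hij
    apply Fin.ext
    rw [← hev i, ← hev j, hij]
  -- evaluation of products of left insertions
  have ev : ∀ (Y : Fin (m + 1) → H) (f : T16F k H N) (v : Fin (N + 1) → H),
      (List.ofFn fun i => t16L k H N (e i) (Y i)).prod f v =
        f (fun p => if hp : (p : ℕ) < m + 1 then Y ⟨p, hp⟩ * v p else v p) := by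
    intro Y f v
    apply t16L_prod (m + 1) e he
    · intro i
      have : (e i : ℕ) < m + 1 := by rw [hev]; exact i.isLt
      rw [dif_pos this]
      congr 2
      exact Fin.ext (hev i)
    · intro p hp
      rw [dif_neg]
      intro hlt
      exact hp ⟨p, hlt⟩ (Fin.ext (hev _))
  have hsw : ∀ j, (List.ofFn fun i : Fin (m + 1) =>
      t16R k H N (Fin.ofNat (N + 1) (K + i)) (X j i)).prod (t16f0 lam D σ) =
      (List.ofFn fun i => t16L k H N (e i) (antipode k (antipode k (X j i)))).prod
        (t16f0 lam D σ) := by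
    intro j
    apply t16_swap
    · intro i
      symm
      apply t16_nbr lam D
      · intro p a b
        exact t16_Spow_mul Sinv h1 h2 _ a b
      · apply t16_perm (n := N + 1) (K := K) (by omega) rfl σ hσ
        · rw [hev]; omega
        · rw [hev, hv _ (by omega)]; omega
      · change Spow k H (antipode k) Sinv (2 * c ((e i : ℕ) + 1)) _ =
          Spow k H (antipode k) Sinv (2 * c ((Fin.ofNat (N + 1) (K + i) : Fin (N + 1)) + 1)) _
        rw [hev, hv _ (by omega)]
        have := hc.2.1 (i + 1) (by omega) (by omega)
        rw [show (i : ℕ) + 1 + K = K + i + 1 by omega] at this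
        rw [this, t16_Spow_succ Sinv h1 h2]
    · intro i j
      exact (t16LR_comm _ _ _ _).symm
    · intro i j hij
      exact t16LL_comm _ _ (fun h => hij (he h)) _ _
  have kl : ∀ i, (∑ j, (List.ofFn fun i : Fin (m + 1) =>
      toConv (t16L k H N (Fin.ofNat (N + 1) i)) (X j i)).prod) (t16W w (t16f0 lam D σ)) (L i) =
      ∑ j, lam (antipode k ((List.ofFn (fun t : Fin (N + 1) =>
        (fun ℓ : Fin (N + 1) =>
          if hℓ : (ℓ : ℕ) < m + 1 then
            Spow k H (antipode k) Sinv (2 * c ((ℓ : ℕ) + 1))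
              (w ⟨(ℓ : ℕ), hℓ⟩ * X j ⟨(ℓ : ℕ), hℓ⟩ * L i ℓ)
          else
            Spow k H (antipode k) Sinv (2 * c ((ℓ : ℕ) + 1)) (L i ℓ)) (σ t))).prod)) := by
    intro i
    rw [LinearMap.sum_apply, sum_apply]
    refine Finset.sum_congr rfl fun j _ => ?_
    refine (ev (X j) _ (L i)).trans ?_
    refine (ev w _ _).trans ?_
    rw [t16f0_apply]
    congr 4
    funext t
    by_cases ht : (σ t : ℕ) < m + 1
    · simp only [dif_pos ht, D, mul_assoc]
    · simp only [dif_neg ht, D]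
  have kr : ∀ i, (∑ j, (List.ofFn fun i : Fin (m + 1) =>
      toConv (t16R k H N (Fin.ofNat (N + 1) (K + i))) (X j i)).prod)
        (t16W w (t16f0 lam D σ)) (L i) =
      ∑ j, lam (antipode k ((List.ofFn (fun t : Fin (N + 1) =>
        (fun ℓ : Fin (N + 1) =>
          if hℓ : (ℓ : ℕ) < m + 1 then
            Spow k H (antipode k) Sinv (2 * c ((ℓ : ℕ) + 1))
              (antipode k (antipode k (X j ⟨(ℓ : ℕ), hℓ⟩)) * w ⟨(ℓ : ℕ), hℓ⟩ * L i ℓ)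
          else
            Spow k H (antipode k) Sinv (2 * c ((ℓ : ℕ) + 1)) (L i ℓ)) (σ t))).prod)) := by
    intro i
    rw [LinearMap.sum_apply, sum_apply]
    refine Finset.sum_congr rfl fun j _ => ?_
    have a1 := t16W_comRprod w (fun i : Fin (m + 1) => Fin.ofNat (N + 1) (K + i)) (X j)
      (t16f0 lam D σ)
    rw [hsw] at a1
    refine (congrArg (fun f : T16F k H N => f (L i)) a1).trans ?_
    refine (ev w _ (L i)).trans ?_
    refine (ev _ _ _).trans ?_
    rw [t16f0_apply]
    congr 4
    funext t
    by_cases ht : (σ t : ℕ) < m + 1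
    · simp only [dif_pos ht, D, mul_assoc]
    · simp only [dif_neg ht, D]
  rw [← Finset.sum_congr rfl fun i _ => kl i, ← Finset.sum_congr rfl fun i _ => kr i]
  exact key

end T16Main

theorem statement16
    (k H : Type) [Field k] [Ring H] [HopfAlgebra k H] [FiniteDimensional k H]
    (S Sinv : H →ₗ[k] H) (hS : S = HopfAlgebra.antipode (R := k))
    (hSinv₁ : ∀ h : H, Sinv (S h) = h) (hSinv₂ : ∀ h : H, S (Sinv h) = h)
    (lam : H →ₗ[k] k) (Λ : H)
    (hΛ : ∀ h : H, h * Λ = Coalgebra.counit (R := k) h • Λ)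
    (hlam : ∀ h : H,
      (TensorProduct.lid k H) ((TensorProduct.map lam LinearMap.id)
        (Coalgebra.comul (R := k) h)) = lam h • (1 : H))
    (hnorm : lam Λ = 1)
    (α : H →ₗ[k] k) (hα : ∀ h : H, Λ * h = α h • Λ)
    (n K : ℕ) (hK : 0 < K) (hKn : K < n) (hcop : Nat.Coprime n K)
    (hodd : Odd (n - K))
    (k₀ : ℕ) (hk₀ : k₀ = (n - K - 1) / 2)
    (c : ℕ → ℤ) (hc : IsCSeq n K c)
    -- the permutation σ_{(n,−K)} ∈ Sym_n (0-based on Fin n = Fin (n-1+1)) :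
    (σ : Equiv.Perm (Fin (n - 1 + 1)))
    (hσ : ∀ t : Fin (n - 1 + 1), ((σ t : ℕ) + 1 + ((t : ℕ) + 1) * K) % n = 0)
    -- the elements x and w₁, …, w_{k₀} :
    (x : H) (w : Fin k₀ → H)
    -- finite-sum representations of Δⁿ(Λ) and of Δ^{k₀}(x) :
    (m₁ : ℕ) (L : Fin m₁ → Fin (n - 1 + 1) → H)
    (hrepΛ : comulIter k H (n - 1) Λ = ∑ i, nest k H (n - 1) (L i))
    (m₂ : ℕ) (X : Fin m₂ → Fin (k₀ - 1 + 1) → H)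
    (hrepx : comulIter k H (k₀ - 1) x = ∑ j, nest k H (k₀ - 1) (X j)) :
    (∑ i, ∑ j, lam (S ((List.ofFn (fun t : Fin (n - 1 + 1) =>
        (fun ℓ : Fin (n - 1 + 1) =>
          if hℓ : (ℓ : ℕ) < k₀ then
            Spow k H S Sinv (2 * c ((ℓ : ℕ) + 1))
              (w ⟨(ℓ : ℕ), hℓ⟩ * X j ⟨(ℓ : ℕ), by omega⟩ * L i ℓ)
          else
            Spow k H S Sinv (2 * c ((ℓ : ℕ) + 1)) (L i ℓ)) (σ t))).prod))) =
    (∑ i, ∑ j, lam (S ((List.ofFn (fun t : Fin (n - 1 + 1) =>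
        (fun ℓ : Fin (n - 1 + 1) =>
          if hℓ : (ℓ : ℕ) < k₀ then
            Spow k H S Sinv (2 * c ((ℓ : ℕ) + 1))
              (S (S (X j ⟨(ℓ : ℕ), by omega⟩)) * w ⟨(ℓ : ℕ), hℓ⟩ * L i ℓ)
          else
            Spow k H S Sinv (2 * c ((ℓ : ℕ) + 1)) (L i ℓ)) (σ t))).prod))) := by
  subst hS
  obtain ⟨N, rfl⟩ : ∃ N, n = N + 1 := ⟨n - 1, by omega⟩
  rcases k₀ with _ | m
  · simp only [Nat.not_lt_zero, dif_neg, not_false_eq_true]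
  · obtain ⟨d, hd⟩ := hodd
    exact t16_main Sinv hSinv₁ hSinv₂ lam Λ hΛ hlam hnorm α hα K m hK (by omega) c hc σ hσ x w
      m₁ L hrepΛ m₂ X hrepx
end

section
/- Let H be a finite-dimensional Hopf algebra over a field k with antipode S, normalized integrals λ, Λ. For positive integers m, n define the linear operator Ψ^{m,n} : H⊗H → H⊗H by Ψ^{m,n}(x ⊗ y) = S⁻²(y₍₄₎)S⁻¹(x₍₂₎)y₍₂₎P^{(m−1)}(x₍₄₎) ⊗ P^{(n−1)}(y₍₁₎)x₍₃₎S⁻¹(y₍₃₎)S⁻²(x₍₁₎), where Δ⁴(x) = x₍₁₎⊗x₍₂₎⊗x₍₃₎⊗x₍₄₎ and P^{(r)} is the r-th Sweedler power. Then Tr((S ⊗ S) ∘ Ψ^{m,n}) = λS(S⁻²(Λ²₍₄₎)S⁻¹(Λ¹₍₂₎)Λ²₍₂₎P^{(m)}(Λ¹₍₄₎)) · λS(P^{(n−1)}(Λ²₍₁₎)Λ¹₍₃₎S⁻¹(Λ²₍₃₎)S⁻²(Λ¹₍₁₎)Λ²₍₅₎), where Λ¹, Λ² are two copies of Λ with Δ⁴(Λ¹)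 and Δ⁵(Λ²) written in Sweedler notation. -/
/-!
STATEMENT 18 (Theorem `t:genus_2`, trace formula):
For a finite-dimensional Hopf algebra H with antipode S (inverse S⁻¹) and normalized
integrals λ, Λ, and positive integers m, n, define Ψ^{m,n} : H⊗H → H⊗H by
  Ψ^{m,n}(x ⊗ y) = S⁻²(y₍₄₎)S⁻¹(x₍₂₎)y₍₂₎P^{(m−1)}(x₍₄₎)
                     ⊗ P^{(n−1)}(y₍₁₎)x₍₃₎S⁻¹(y₍₃₎)S⁻²(x₍₁₎).
Then
  Tr((S ⊗ S) ∘ Ψ^{m,n})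
    = λS(S⁻²(Λ²₍₄₎)S⁻¹(Λ¹₍₂₎)Λ²₍₂₎P^{(m)}(Λ¹₍₄₎))
        · λS(P^{(n−1)}(Λ²₍₁₎)Λ¹₍₃₎S⁻¹(Λ²₍₃₎)S⁻²(Λ¹₍₁₎)Λ²₍₅₎),
where Λ¹, Λ² are two copies of Λ, with Δ⁴(Λ¹) and Δ⁵(Λ²) encoded by finite-sum
representations.  (This common value is the Kuperberg invariant K(𝕄_{m,n}, 𝔣_{m,n}, H).)
-/

open TensorProduct

section
variable (k H : Type) [Field k] [Ring H] [HopfAlgebra k H]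

/-- iterated comultiplications into right-nested tensor powers (fixed small arity). -/
noncomputable def comul2 : H →ₗ[k] H ⊗[k] H := Coalgebra.comul
noncomputable def comul3 : H →ₗ[k] H ⊗[k] (H ⊗[k] H) :=
  (TensorProduct.map LinearMap.id (comul2 k H)) ∘ₗ Coalgebra.comul
noncomputable def comul4 : H →ₗ[k] H ⊗[k] (H ⊗[k] (H ⊗[k] H)) :=
  (TensorProduct.map LinearMap.id (comul3 k H)) ∘ₗ Coalgebra.comul
noncomputable def comul5 : H →ₗ[k] H ⊗[k] (H ⊗[k] (H ⊗[k] (H ⊗[k] H))) :=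
  (TensorProduct.map LinearMap.id (comul4 k H)) ∘ₗ Coalgebra.comul

/-- The r-th Sweedler power map `P^{(r)}(x) = x₍₁₎⋯x₍ᵣ₎` (r-th convolution power of id). -/
noncomputable def sweedlerPow : ℕ → (H →ₗ[k] H)
  | 0 => (Algebra.linearMap k H) ∘ₗ Coalgebra.counit
  | r + 1 => LinearMap.mul' k H ∘ₗ
      (TensorProduct.map LinearMap.id (sweedlerPow r)) ∘ₗ Coalgebra.comul

end

section helpers
variable {k H : Type} [Field k] [Ring H] [HopfAlgebra k H]

/-- `λ(x₁ y) x₂ = λ(x y₁) S(y₂)` specialised to `y = Λ`. -/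
lemma radford_aux (lam : H →ₗ[k] k) (Λ : H)
    (hΛ : ∀ h : H, h * Λ = Coalgebra.counit (R := k) h • Λ)
    (hlam : ∀ h : H,
      (TensorProduct.lid k H) ((TensorProduct.map lam LinearMap.id)
        (Coalgebra.comul (R := k) h)) = lam h • (1 : H))
    (hnorm : lam Λ = 1) (N : ℕ) (a b : Fin N → H)
    (hab : Coalgebra.comul (R := k) Λ = ∑ i, a i ⊗ₜ[k] b i) (x : H) :
    ∑ i, lam (x * a i) • HopfAlgebra.antipode k (b i) = x := by
  let rx := Coalgebra.Repr.arbitrary k x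
  let Nf : H → H → (H ⊗[k] (H ⊗[k] H) →ₗ[k] H) := fun p q =>
    (TensorProduct.lid k H).toLinearMap ∘ₗ
      TensorProduct.map (lam ∘ₗ LinearMap.mulLeft k p)
        (LinearMap.mulLeft k q ∘ₗ LinearMap.mul' k H ∘ₗ
          (HopfAlgebra.antipode k).lTensor H)
  have key : ∀ p q c d : H, (TensorProduct.lid k H) ((TensorProduct.map lam LinearMap.id)
        ((p ⊗ₜ[k] q) * Coalgebra.comul (R := k) c)) * HopfAlgebra.antipode k d =
        Nf p q (TensorProduct.assoc k H H H (Coalgebra.comul (R := k) c ⊗ₜ[k] d)) := by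
    intro p q c d
    generalize Coalgebra.comul (R := k) c = t
    induction t with
    | zero => simp
    | add u v hu hv => simp only [mul_add, map_add, add_mul, TensorProduct.add_tmul, hu, hv]
    | tmul u v => simp [Nf, mul_assoc]
  have key2 : ∀ p q : H, Nf p q (TensorProduct.assoc k H H H
      ((Coalgebra.comul (R := k)).rTensor H (Coalgebra.comul (R := k) Λ))) =
      lam (p * Λ) • q := by
    intro p q
    rw [Coalgebra.coassoc_apply]
    have h1 : ∀ c d : H, Nf p q (c ⊗ₜ[k] Coalgebra.comul (R := k) d) =
        lam (p * c) • (q * algebraMap k H (Coalgebra.counit (R := k) d)) := by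
      intro c d
      simp [Nf]
    have h2 : ∑ i, Coalgebra.counit (R := k) (b i) • a i = Λ := by
      have := Coalgebra.lTensor_counit_comul (R := k) Λ
      rw [hab] at this
      have := congrArg (TensorProduct.rid k H) this
      simpa using this
    rw [hab]
    simp only [map_sum, LinearMap.lTensor_tmul, h1]
    conv_rhs => rw [← h2]
    simp only [Finset.mul_sum, map_sum, Finset.sum_smul]
    refine Finset.sum_congr rfl fun i _ => ?_
    rw [Algebra.algebraMap_eq_smul_one]
    simp [smul_smul, mul_comm]
  calc ∑ i, lam (x * a i) • HopfAlgebra.antipode k (b i)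
      = ∑ i, ((TensorProduct.lid k H) ((TensorProduct.map lam LinearMap.id)
        (Coalgebra.comul (R := k) (x * a i)))) * HopfAlgebra.antipode k (b i) := by
        refine Finset.sum_congr rfl fun i _ => ?_
        rw [hlam]; simp
    _ = ∑ i, ∑ s ∈ rx.index, Nf (rx.left s) (rx.right s)
          (TensorProduct.assoc k H H H (Coalgebra.comul (R := k) (a i) ⊗ₜ[k] b i)) := by
        refine Finset.sum_congr rfl fun i _ => ?_
        rw [Bialgebra.comul_mul, ← rx.eq, Finset.sum_mul, map_sum, map_sum, Finset.sum_mul]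
        exact Finset.sum_congr rfl fun s _ => key _ _ _ _
    _ = ∑ s ∈ rx.index, lam (rx.left s * Λ) • rx.right s := by
        rw [Finset.sum_comm]
        refine Finset.sum_congr rfl fun s _ => ?_
        rw [← key2, hab]
        simp [map_sum]
    _ = x := by
        simp only [hΛ, map_smul, hnorm, smul_eq_mul, mul_one]
        exact Coalgebra.sum_counit_smul rx

/-- The dual-basis form of Radford's trace formula. -/
lemma radford_dual [FiniteDimensional k H] (lam : H →ₗ[k] k) (Λ : H)
    (hΛ : ∀ h : H, h * Λ = Coalgebra.counit (R := k) h • Λ)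
    (hlam : ∀ h : H,
      (TensorProduct.lid k H) ((TensorProduct.map lam LinearMap.id)
        (Coalgebra.comul (R := k) h)) = lam h • (1 : H))
    (hnorm : lam Λ = 1) (N : ℕ) (a b : Fin N → H)
    (hab : Coalgebra.comul (R := k) Λ = ∑ i, a i ⊗ₜ[k] b i) (y : H) :
    ∑ i, lam (HopfAlgebra.antipode k (b i) * y) • a i = y := by
  have haux := radford_aux lam Λ hΛ hlam hnorm N a b hab
  let B : H →ₗ[k] Module.Dual k H := (LinearMap.mul k H).compr₂ lam
  have hB : ∀ x z, B x z = lam (x * z) := fun x z => rfl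
  have hinj : Function.Injective B := by
    rw [injective_iff_map_eq_zero]
    intro x hx
    rw [← haux x]
    refine Finset.sum_eq_zero fun i _ => ?_
    rw [← hB, hx]; simp
  have hsurj : Function.Surjective B :=
    (LinearMap.injective_iff_surjective_of_finrank_eq_finrank
      (Subspace.dual_finrank_eq).symm).1 hinj
  rw [← sub_eq_zero, ← Module.forall_dual_apply_eq_zero_iff k]
  intro φ
  obtain ⟨x, rfl⟩ := hsurj φ
  rw [map_sub, sub_eq_zero, map_sum]
  conv_rhs => rw [← haux x]
  simp only [map_sum, map_smul, LinearMap.sum_apply, LinearMap.smul_apply, hB, smul_eq_mul,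
    mul_smul_comm]
  exact Finset.sum_congr rfl fun i _ => mul_comm _ _

lemma trace_dual {V ι : Type} [Fintype ι] [AddCommGroup V] [Module k V] [FiniteDimensional k V]
    (φ : ι → V →ₗ[k] k) (v : ι → V) (h : ∀ x, ∑ i, φ i x • v i = x) (f : V →ₗ[k] V) :
    LinearMap.trace k V f = ∑ i, φ i (f (v i)) := by
  have : f = ∑ i, (φ i).smulRight (f (v i)) := by
    ext x
    conv_lhs => rw [← h x]
    simp
  conv_lhs => rw [this]
  simp [map_sum, LinearMap.trace_smulRight]

lemma trace_tensor_dual [FiniteDimensional k H] {N : ℕ} (φ : Fin N → H →ₗ[k] k) (v : Fin N → H)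
    (h : ∀ x, ∑ i, φ i x • v i = x) (f : H ⊗[k] H →ₗ[k] H ⊗[k] H) :
    LinearMap.trace k _ f = ∑ i, ∑ j,
      LinearMap.mul' k k (TensorProduct.map (φ i) (φ j) (f (v i ⊗ₜ[k] v j))) := by
  rw [← Fintype.sum_prod_type' (f := fun i j =>
    LinearMap.mul' k k (TensorProduct.map (φ i) (φ j) (f (v i ⊗ₜ[k] v j))))]
  refine trace_dual
    (φ := fun ij : Fin N × Fin N => LinearMap.mul' k k ∘ₗ TensorProduct.map (φ ij.1) (φ ij.2))
    (v := fun ij => v ij.1 ⊗ₜ[k] v ij.2) ?_ f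
  intro t
  induction t with
  | zero => simp
  | add u w hu hw =>
    simp only [map_add, add_smul, Finset.sum_add_distrib, hu, hw]
  | tmul x y =>
    rw [Fintype.sum_prod_type]
    conv_rhs => rw [← h x, ← h y]
    simp only [TensorProduct.sum_tmul, TensorProduct.tmul_sum, TensorProduct.smul_tmul_smul]
    rw [Finset.sum_comm]
    simp [LinearMap.mul'_apply]

lemma multi2 {U V : Type} [AddCommGroup V] [Module k V]
    [AddCommGroup U] [Module k U]
    (f : U → V → k) (h1 : ∀ y, IsLinearMap k (fun x => f x y))
    (h2 : ∀ x, IsLinearMap k (fun y => f x y)) :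
    ∃ F : U ⊗[k] V →ₗ[k] k, ∀ x y, F (x ⊗ₜ y) = f x y :=
  ⟨TensorProduct.lift (LinearMap.mk₂ k f (fun x x' y => (h1 y).map_add x x')
    (fun c x y => (h1 y).map_smul c x) (fun x y y' => (h2 x).map_add y y')
    (fun c x y => (h2 x).map_smul c y)), fun x y => by simp⟩

lemma multi3 (f : H → H → H → k)
    (h1 : ∀ y z, IsLinearMap k (fun x => f x y z))
    (h2 : ∀ x z, IsLinearMap k (fun y => f x y z))
    (h3 : ∀ x y, IsLinearMap k (fun z => f x y z)) :
    ∃ F : H ⊗[k] (H ⊗[k] H) →ₗ[k] k, ∀ x y z, F (x ⊗ₜ (y ⊗ₜ z)) = f x y z := by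
  choose F hF using fun x => multi2 (f x) (h2 x) (h3 x)
  obtain ⟨G, hG⟩ := multi2 (fun x t => F x t) (fun t => by
    refine ⟨fun x x' => ?_, fun c x => ?_⟩
    · have : F (x + x') = F x + F x' := by
        ext y z
        simpa [hF] using (h1 y z).map_add x x'
      simp [this]
    · have : F (c • x) = c • F x := by
        ext y z
        simpa [hF] using (h1 y z).map_smul c x
      simp [this]) (fun x => (F x).isLinear)
  exact ⟨G, fun x y z => by rw [hG, hF]⟩

lemma multi4 (f : H → H → H → H → k)
    (h1 : ∀ y z w, IsLinearMap k (fun x => f x y z w))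
    (h2 : ∀ x z w, IsLinearMap k (fun y => f x y z w))
    (h3 : ∀ x y w, IsLinearMap k (fun z => f x y z w))
    (h4 : ∀ x y z, IsLinearMap k (fun w => f x y z w)) :
    ∃ F : H ⊗[k] (H ⊗[k] (H ⊗[k] H)) →ₗ[k] k,
      ∀ x y z w, F (x ⊗ₜ (y ⊗ₜ (z ⊗ₜ w))) = f x y z w := by
  choose F hF using fun x => multi3 (f x) (h2 x) (h3 x) (h4 x)
  obtain ⟨G, hG⟩ := multi2 (fun x t => F x t) (fun t => by
    refine ⟨fun x x' => ?_, fun c x => ?_⟩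
    · have : F (x + x') = F x + F x' := by
        ext y z w
        simpa [hF] using (h1 y z w).map_add x x'
      simp [this]
    · have : F (c • x) = c • F x := by
        ext y z w
        simpa [hF] using (h1 y z w).map_smul c x
      simp [this]) (fun x => (F x).isLinear)
  exact ⟨G, fun x y z w => by rw [hG, hF]⟩

lemma multi5 (f : H → H → H → H → H → k)
    (h1 : ∀ y z w u, IsLinearMap k (fun x => f x y z w u))
    (h2 : ∀ x z w u, IsLinearMap k (fun y => f x y z w u))
    (h3 : ∀ x y w u, IsLinearMap k (fun z => f x y z w u))
    (h4 : ∀ x y z u, IsLinearMap k (fun w => f x y z w u))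
    (h5 : ∀ x y z w, IsLinearMap k (fun u => f x y z w u)) :
    ∃ F : H ⊗[k] (H ⊗[k] (H ⊗[k] (H ⊗[k] H))) →ₗ[k] k,
      ∀ x y z w u, F (x ⊗ₜ (y ⊗ₜ (z ⊗ₜ (w ⊗ₜ u)))) = f x y z w u := by
  choose F hF using fun x => multi4 (f x) (h2 x) (h3 x) (h4 x) (h5 x)
  obtain ⟨G, hG⟩ := multi2 (fun x t => F x t) (fun t => by
    refine ⟨fun x x' => ?_, fun c x => ?_⟩
    · have : F (x + x') = F x + F x' := by
        ext y z w u
        simpa [hF] using (h1 y z w u).map_add x x'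
      simp [this]
    · have : F (c • x) = c • F x := by
        ext y z w u
        simpa [hF] using (h1 y z w u).map_smul c x
      simp [this]) (fun x => (F x).isLinear)
  exact ⟨G, fun x y z w u => by rw [hG, hF]⟩

lemma exists_rep2 {U V : Type} [AddCommGroup V] [Module k V]
    [AddCommGroup U] [Module k U] (t : U ⊗[k] V) :
    ∃ (N : ℕ) (a : Fin N → U) (b : Fin N → V), t = ∑ i, a i ⊗ₜ[k] b i := by
  induction t with
  | zero => exact ⟨0, Fin.elim0, Fin.elim0, by simp⟩
  | tmul x y => exact ⟨1, fun _ => x, fun _ => y, by simp⟩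
  | add u v hu hv =>
    obtain ⟨N, a, b, rfl⟩ := hu
    obtain ⟨M, c, d, rfl⟩ := hv
    exact ⟨N + M, Fin.append a c, Fin.append b d, by simp [Fin.sum_univ_add]⟩

lemma exists_rep4 (t : H ⊗[k] (H ⊗[k] (H ⊗[k] H))) :
    ∃ (N : ℕ) (a b c d : Fin N → H),
      t = ∑ i, a i ⊗ₜ[k] (b i ⊗ₜ[k] (c i ⊗ₜ[k] d i)) := by
  let P : H ⊗[k] (H ⊗[k] (H ⊗[k] H)) → Prop := fun t => ∃ (N : ℕ) (a b c d : Fin N → H),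
      t = ∑ i, a i ⊗ₜ[k] (b i ⊗ₜ[k] (c i ⊗ₜ[k] d i))
  have h0 : P 0 := ⟨0, Fin.elim0, Fin.elim0, Fin.elim0, Fin.elim0, by simp⟩
  have hadd : ∀ u v, P u → P v → P (u + v) := by
    rintro _ _ ⟨N, a, b, c, d, rfl⟩ ⟨M, a', b', c', d', rfl⟩
    exact ⟨N + M, Fin.append a a', Fin.append b b', Fin.append c c', Fin.append d d',
      by simp [Fin.sum_univ_add]⟩
  have hsum : ∀ (N : ℕ) (g : Fin N → H ⊗[k] (H ⊗[k] (H ⊗[k] H))),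
      (∀ i, P (g i)) → P (∑ i, g i) := fun N g hg =>
    Finset.sum_induction g P hadd h0 (fun i _ => hg i)
  obtain ⟨N, a, u, rfl⟩ := exists_rep2 t
  refine hsum _ _ fun i => ?_
  obtain ⟨N2, b, v, h2⟩ := exists_rep2 (u i)
  rw [h2, TensorProduct.tmul_sum]
  refine hsum _ _ fun i2 => ?_
  obtain ⟨N3, c, d, h3⟩ := exists_rep2 (v i2)
  rw [h3, TensorProduct.tmul_sum, TensorProduct.tmul_sum]
  exact hsum _ _ fun i3 => ⟨1, fun _ => _, fun _ => _, fun _ => _, fun _ => _, by simp; rfl⟩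

lemma coassoc_step {M M' : Type} [AddCommGroup M] [Module k M] [AddCommGroup M'] [Module k M']
    (D : H →ₗ[k] M) (D' : H →ₗ[k] M') (α : M ⊗[k] H →ₗ[k] M')
    (h : ∀ x, α (D.rTensor H (Coalgebra.comul (R := k) x)) = D' x) (x : H) :
    α.lTensor H (TensorProduct.assoc k H M H
      (((TensorProduct.map LinearMap.id D) ∘ₗ Coalgebra.comul).rTensor H
        (Coalgebra.comul (R := k) x))) =
    TensorProduct.map LinearMap.id D' (Coalgebra.comul (R := k) x) := by
  have h' : α ∘ₗ D.rTensor H ∘ₗ Coalgebra.comul = D' := LinearMap.ext h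
  have e1 : ∀ t : (H ⊗[k] H) ⊗[k] H,
      TensorProduct.assoc k H M H ((TensorProduct.map LinearMap.id D).rTensor H t) =
      (D.rTensor H).lTensor H (TensorProduct.assoc k H H H t) := by
    intro t
    have : (TensorProduct.assoc k H M H).toLinearMap ∘ₗ
        ((TensorProduct.map LinearMap.id D).rTensor H) =
        (D.rTensor H).lTensor H ∘ₗ (TensorProduct.assoc k H H H).toLinearMap := by
      ext; simp
    exact LinearMap.congr_fun this t
  rw [LinearMap.rTensor_comp_apply, e1, Coalgebra.coassoc_apply, ← h',
    ← LinearMap.lTensor_comp_apply, ← LinearMap.lTensor_comp_apply]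
  rfl

lemma comul5_rep (x : H) (N : ℕ) (a b : Fin N → H)
    (hab : Coalgebra.comul (R := k) x = ∑ i, a i ⊗ₜ[k] b i)
    (R : Fin N → ℕ) (U₁ U₂ U₃ U₄ : ∀ i, Fin (R i) → H)
    (hU : ∀ i, comul4 k H (a i) =
      ∑ s, U₁ i s ⊗ₜ[k] (U₂ i s ⊗ₜ[k] (U₃ i s ⊗ₜ[k] U₄ i s))) :
    comul5 k H x = ∑ i, ∑ s,
      U₁ i s ⊗ₜ[k] (U₂ i s ⊗ₜ[k] (U₃ i s ⊗ₜ[k] (U₄ i s ⊗ₜ[k] b i))) := by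
  have s2 := coassoc_step (comul2 k H) (comul3 k H) (TensorProduct.assoc k H H H).toLinearMap
    (fun x => Coalgebra.coassoc_apply x)
  have s3 := coassoc_step (comul3 k H) (comul4 k H)
    ((TensorProduct.assoc k H H H).toLinearMap.lTensor H ∘ₗ
      (TensorProduct.assoc k H (H ⊗[k] H) H).toLinearMap) (fun x => s2 x)
  have s4 := s3 x
  have e : comul5 k H x =
    TensorProduct.map LinearMap.id (comul4 k H) (Coalgebra.comul (R := k) x) := rfl
  rw [e, ← s4, hab]
  have e4 : (TensorProduct.map LinearMap.id (comul3 k H)) ∘ₗ Coalgebra.comul = comul4 k H := rfl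
  rw [e4]
  simp [map_sum, hU, TensorProduct.sum_tmul]

lemma comul5_eq (x : H) : comul5 k H x =
    (((Coalgebra.comul (R := k) (A := H)).lTensor H).lTensor H).lTensor H (comul4 k H x) := by
  have : ∀ {M M' : Type} [AddCommGroup M] [Module k M] [AddCommGroup M'] [Module k M']
      (D : H →ₗ[k] M) (g : M →ₗ[k] M'), TensorProduct.map LinearMap.id (g ∘ₗ D) =
      g.lTensor H ∘ₗ TensorProduct.map (LinearMap.id : H →ₗ[k] H) D := by
    intros; ext; simp
  have h3 : comul3 k H = (Coalgebra.comul (R := k) (A := H)).lTensor H ∘ₗ comul2 k H := rfl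
  have h4 : comul4 k H = ((Coalgebra.comul (R := k) (A := H)).lTensor H).lTensor H ∘ₗ
      comul3 k H := by
    conv_lhs => rw [comul4, h3, this]
    rfl
  have h5 : comul5 k H = (((Coalgebra.comul (R := k) (A := H)).lTensor H).lTensor H).lTensor H ∘ₗ
      comul4 k H := by
    conv_lhs => rw [comul5, h4, this]
    rfl
  rw [h5]; rfl

/-- `P^{(r+1)} = P^{(r)} * id` (convolution). -/
lemma sweedlerPow_succ' (r : ℕ) : sweedlerPow k H (r + 1) = LinearMap.mul' k H ∘ₗ
      (TensorProduct.map (sweedlerPow k H r) LinearMap.id) ∘ₗ Coalgebra.comul := by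
  have h : ∀ r, WithConv.toConv (sweedlerPow k H r) =
      (WithConv.toConv (LinearMap.id : H →ₗ[k] H)) ^ r := by
    intro r
    induction r with
    | zero => rw [pow_zero]; rfl
    | succ r ih => rw [pow_succ', ← ih]; rfl
  have := h (r + 1)
  rw [pow_succ, ← h r] at this
  exact congrArg WithConv.ofConv this

end helpers

theorem statement18
    (k H : Type) [Field k] [Ring H] [HopfAlgebra k H] [FiniteDimensional k H]
    (S Sinv : H →ₗ[k] H) (hS : S = HopfAlgebra.antipode (R := k))
    (hSinv₁ : ∀ h : H, Sinv (S h) = h) (hSinv₂ : ∀ h : H, S (Sinv h) = h)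
    (lam : H →ₗ[k] k) (Λ : H)
    (hΛ : ∀ h : H, h * Λ = Coalgebra.counit (R := k) h • Λ)
    (hlam : ∀ h : H,
      (TensorProduct.lid k H) ((TensorProduct.map lam LinearMap.id)
        (Coalgebra.comul (R := k) h)) = lam h • (1 : H))
    (hnorm : lam Λ = 1)
    (m n : ℕ) (hm : 1 ≤ m) (hn : 1 ≤ n)
    -- the operator Ψ^{m,n}, characterized on finite-sum representations of the
    -- 4-fold comultiplications of x and y :
    (Ψ : H ⊗[k] H →ₗ[k] H ⊗[k] H)
    (hΨ : ∀ (x y : H) (rx ry : ℕ)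
        (X : Fin rx → H) (X₂ : Fin rx → H) (X₃ : Fin rx → H) (X₄ : Fin rx → H)
        (Y₁ : Fin ry → H) (Y₂ : Fin ry → H) (Y₃ : Fin ry → H) (Y₄ : Fin ry → H),
      comul4 k H x = ∑ i, X i ⊗ₜ[k] (X₂ i ⊗ₜ[k] (X₃ i ⊗ₜ[k] X₄ i)) →
      comul4 k H y = ∑ j, Y₁ j ⊗ₜ[k] (Y₂ j ⊗ₜ[k] (Y₃ j ⊗ₜ[k] Y₄ j)) →
      Ψ (x ⊗ₜ[k] y) = ∑ i, ∑ j,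
        (Sinv (Sinv (Y₄ j)) * Sinv (X₂ i) * Y₂ j * sweedlerPow k H (m - 1) (X₄ i))
          ⊗ₜ[k]
        (sweedlerPow k H (n - 1) (Y₁ j) * X₃ i * Sinv (Y₃ j) * Sinv (Sinv (X i))))
    -- finite-sum representations of Δ⁴(Λ¹) and Δ⁵(Λ²) :
    (r₁ r₂ : ℕ)
    (A₁ A₂ A₃ A₄ : Fin r₁ → H)
    (hrep₁ : comul4 k H Λ = ∑ i, A₁ i ⊗ₜ[k] (A₂ i ⊗ₜ[k] (A₃ i ⊗ₜ[k] A₄ i)))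
    (B₁ B₂ B₃ B₄ B₅ : Fin r₂ → H)
    (hrep₂ : comul5 k H Λ =
      ∑ j, B₁ j ⊗ₜ[k] (B₂ j ⊗ₜ[k] (B₃ j ⊗ₜ[k] (B₄ j ⊗ₜ[k] B₅ j)))) :
    LinearMap.trace k (H ⊗[k] H) ((TensorProduct.map S S) ∘ₗ Ψ) =
      ∑ i, ∑ j,
        lam (S (Sinv (Sinv (B₄ j)) * Sinv (A₂ i) * B₂ j *
            sweedlerPow k H m (A₄ i))) *
        lam (S (sweedlerPow k H (n - 1) (B₁ j) * A₃ i * Sinv (B₃ j) *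
            Sinv (Sinv (A₁ i)) * B₅ j)) := by
  subst hS
  obtain ⟨N, a, b, hab⟩ := exists_rep2 (Coalgebra.comul (R := k) Λ)
  choose R U₁ U₂ U₃ U₄ hU using fun i => exists_rep4 (comul4 k H (a i))
  have hdual := radford_dual lam Λ hΛ hlam hnorm N a b hab
  obtain ⟨m, rfl⟩ : ∃ m', m = m' + 1 := ⟨m - 1, by omega⟩
  simp only [Nat.add_sub_cancel] at hΨ
  have h5 := comul5_rep Λ N a b hab R U₁ U₂ U₃ U₄ hU
  have h5' := comul5_eq (k := k) Λ
  -- the fourth slot of the first copy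
  have hP : ∑ i, ∑ s, U₁ i s ⊗ₜ[k] (U₂ i s ⊗ₜ[k] (U₃ i s ⊗ₜ[k]
      (sweedlerPow k H m (U₄ i s) * b i))) =
      ∑ i, A₁ i ⊗ₜ[k] (A₂ i ⊗ₜ[k] (A₃ i ⊗ₜ[k] sweedlerPow k H (m + 1) (A₄ i))) := by
    rw [h5, hrep₁] at h5'
    have := congrArg ((((LinearMap.mul' k H ∘ₗ
      TensorProduct.map (sweedlerPow k H m) LinearMap.id).lTensor H).lTensor H).lTensor H) h5'
    rw [sweedlerPow_succ']
    simpa [map_sum] using this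
  rw [trace_tensor_dual
    (fun i => lam ∘ₗ LinearMap.mulLeft k (HopfAlgebra.antipode k (b i))) a hdual]
  have hL : ∀ i j, LinearMap.mul' k k (TensorProduct.map
      (lam ∘ₗ LinearMap.mulLeft k (HopfAlgebra.antipode k (b i)))
      (lam ∘ₗ LinearMap.mulLeft k (HopfAlgebra.antipode k (b j)))
      ((TensorProduct.map (HopfAlgebra.antipode k) (HopfAlgebra.antipode k) ∘ₗ Ψ)
        (a i ⊗ₜ[k] a j))) = ∑ s, ∑ t,
      lam (HopfAlgebra.antipode k (Sinv (Sinv (U₄ j t)) * Sinv (U₂ i s) * U₂ j t *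
            (sweedlerPow k H m (U₄ i s) * b i))) *
        lam (HopfAlgebra.antipode k (sweedlerPow k H (n - 1) (U₁ j t) * U₃ i s * Sinv (U₃ j t) *
            Sinv (Sinv (U₁ i s)) * b j)) := by
    intro i j
    rw [LinearMap.comp_apply, hΨ _ _ _ _ _ _ _ _ _ _ _ _ (hU i) (hU j)]
    simp only [map_sum, TensorProduct.map_tmul, LinearMap.mul'_apply, LinearMap.comp_apply,
      LinearMap.mulLeft_apply, ← HopfAlgebra.antipode_mul_antidistrib, mul_assoc]
  simp only [hL]
  -- replace the second copy
  have hB : ∀ u₁ u₂ u₃ w : H, ∑ j, ∑ t,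
      lam (HopfAlgebra.antipode k (Sinv (Sinv (U₄ j t)) * Sinv u₂ * U₂ j t * w)) *
        lam (HopfAlgebra.antipode k (sweedlerPow k H (n - 1) (U₁ j t) * u₃ * Sinv (U₃ j t) *
            Sinv (Sinv u₁) * b j)) =
      ∑ j, lam (HopfAlgebra.antipode k (Sinv (Sinv (B₄ j)) * Sinv u₂ * B₂ j * w)) *
        lam (HopfAlgebra.antipode k (sweedlerPow k H (n - 1) (B₁ j) * u₃ * Sinv (B₃ j) *
            Sinv (Sinv u₁) * B₅ j)) := by
    intro u₁ u₂ u₃ w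
    obtain ⟨F, hF⟩ := multi5 (k := k) (fun y₁ y₂ y₃ y₄ y₅ : H =>
      lam (HopfAlgebra.antipode k (Sinv (Sinv y₄) * Sinv u₂ * y₂ * w)) *
        lam (HopfAlgebra.antipode k (sweedlerPow k H (n - 1) y₁ * u₃ * Sinv y₃ *
            Sinv (Sinv u₁) * y₅)))
      (fun _ _ _ _ => ⟨by intros; simp only [map_add, add_mul, mul_add],
        by intros; simp only [map_smul, smul_mul_assoc, mul_smul_comm]⟩)
      (fun _ _ _ _ => ⟨by intros; simp only [map_add, add_mul, mul_add],
        by intros; simp only [map_smul, smul_mul_assoc, mul_smul_comm]⟩)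
      (fun _ _ _ _ => ⟨by intros; simp only [map_add, add_mul, mul_add],
        by intros; simp only [map_smul, smul_mul_assoc, mul_smul_comm]⟩)
      (fun _ _ _ _ => ⟨by intros; simp only [map_add, add_mul, mul_add],
        by intros; simp only [map_smul, smul_mul_assoc, mul_smul_comm]⟩)
      (fun _ _ _ _ => ⟨by intros; simp only [map_add, add_mul, mul_add],
        by intros; simp only [map_smul, smul_mul_assoc, mul_smul_comm]⟩)
    have := congrArg F (h5.symm.trans hrep₂)
    simpa only [map_sum, hF] using this
  obtain ⟨F, hF⟩ := multi4 (k := k) (fun x₁ x₂ x₃ w : H => ∑ j,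
      lam (HopfAlgebra.antipode k (Sinv (Sinv (B₄ j)) * Sinv x₂ * B₂ j * w)) *
        lam (HopfAlgebra.antipode k (sweedlerPow k H (n - 1) (B₁ j) * x₃ * Sinv (B₃ j) *
            Sinv (Sinv x₁) * B₅ j)))
    (fun _ _ _ => ⟨by intros; simp only [map_add, add_mul, mul_add, Finset.sum_add_distrib],
      by intros; simp only [map_smul, smul_mul_assoc, mul_smul_comm, Finset.smul_sum]⟩)
    (fun _ _ _ => ⟨by intros; simp only [map_add, add_mul, mul_add, Finset.sum_add_distrib],
      by intros; simp only [map_smul, smul_mul_assoc, mul_smul_comm, Finset.smul_sum]⟩)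
    (fun _ _ _ => ⟨by intros; simp only [map_add, add_mul, mul_add, Finset.sum_add_distrib],
      by intros; simp only [map_smul, smul_mul_assoc, mul_smul_comm, Finset.smul_sum]⟩)
    (fun _ _ _ => ⟨by intros; simp only [map_add, add_mul, mul_add, Finset.sum_add_distrib],
      by intros; simp only [map_smul, smul_mul_assoc, mul_smul_comm, Finset.smul_sum]⟩)
  have hfin := congrArg F hP
  simp only [map_sum, hF] at hfin
  rw [← hfin]
  refine Finset.sum_congr rfl fun i _ => ?_
  rw [Finset.sum_comm]
  exact Finset.sum_congr rfl fun s _ => hB _ _ _ _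
end
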